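/- arXiv:1409.1168 — 5 statements merged into one kernel-verified Lean document; each statement's English description precedes it below -/
import Mathlib

section
/- B_{α-1} = ⋃_{i=0}^{2(a-1)} g_i(X_i), where X_i = B_{α-1} if i is odd or i = 2(a-1), and X_i = B'_{α-1} if i is even with i < 2(a-1). -/
open Complex Filter Topology

noncomputable section

/-- The word `w₁w₂w₃w₄` is lexicographically smaller than the word `(a-1)(a-1)01`. -/
def WordLt (a : ℤ) (w₁ w₂ w₃ w₄ : ℤ) : Prop :=
  w₁ < a - 1 ∨ (w₁ = a - 1 ∧ (w₂ < a - 1 ∨ (w₂ = a - 1 ∧ (w₃ < 0 ∨ (w₃ = 0 ∧ w₄ < 1)))))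

/-- A sequence of integers `(c i)_{i ≥ k}` with `0 ≤ c i ≤ a-1` is admissible if for every
`i ≥ k+3` the word `c i, c (i-1), c (i-2), c (i-3)` is lexicographically smaller
than `(a-1)(a-1)01`. (Values of `c` below index `k` are irrelevant.) -/
def Admissible (a k : ℤ) (c : ℤ → ℤ) : Prop :=
  (∀ i, k ≤ i → 0 ≤ c i ∧ c i ≤ a - 1) ∧
  (∀ i, k + 3 ≤ i → WordLt a (c i) (c (i - 1)) (c (i - 2)) (c (i - 3)))

/-- The Rauzy fractal `R_a = { Σ_{i=2}^∞ c_i α^i : (c_i)_{i≥2} admissible }`. -/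
def Rauzy (a : ℤ) (α : ℂ) : Set ℂ :=
  {z | ∃ c : ℤ → ℤ, Admissible a 2 c ∧
    z = ∑' n : ℕ, (c ((n : ℤ) + 2) : ℂ) * α ^ (n + 2)}

/-- `B_v = R_a ∩ (R_a + v)`. -/
def BSet (a : ℤ) (α : ℂ) (v : ℂ) : Set ℂ :=
  Rauzy a α ∩ ((· + v) '' Rauzy a α)

/-- `B'_{α-1}`: points of `B_{α-1}` admitting an admissible expansion
`z = α - 1 + Σ_{i=3}^∞ c_i α^i` with `c 3 ≠ a-1`. -/
def Bprime (a : ℤ) (α : ℂ) : Set ℂ :=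
  {z | z ∈ BSet a α (α - 1) ∧ ∃ c : ℤ → ℤ, Admissible a 3 c ∧ c 3 ≠ a - 1 ∧
    z = α - 1 + ∑' n : ℕ, (c ((n : ℤ) + 3) : ℂ) * α ^ (n + 3)}

/-- `g_{2k+1}(z) = -1 - k α³ + α³ z`. -/
def gOdd (α : ℂ) (k : ℤ) (z : ℂ) : ℂ := -1 - (k : ℂ) * α ^ 3 + α ^ 3 * z

/-- `g_{2k}(z) = α - 1 + (a-1-k) α³ + α² z`. -/
def gEven (a : ℤ) (α : ℂ) (k : ℤ) (z : ℂ) : ℂ :=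
  α - 1 + ((a : ℂ) - 1 - (k : ℂ)) * α ^ 3 + α ^ 2 * z

/-- The value `∑ c_{n+k} α^n`. -/
def rval (α : ℂ) (c : ℤ → ℤ) (k : ℤ) : ℂ := ∑' n : ℕ, (c ((n : ℤ) + k) : ℂ) * α ^ n

/-- Digits bounded by `M` in absolute value from index `k` on. -/
def RBd (M k : ℤ) (c : ℤ → ℤ) : Prop := ∀ i, k ≤ i → |c i| ≤ M

lemma RBd.mono {M k l : ℤ} {c : ℤ → ℤ} (h : RBd M k c) (hkl : k ≤ l) : RBd M l c :=
  fun i hi => h i (hkl.trans hi)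

lemma rterm_bound {M k : ℤ} {c : ℤ → ℤ} (α : ℂ) (h : RBd M k c) (n : ℕ) :
    ‖(c ((n : ℤ) + k) : ℂ) * α ^ n‖ ≤ (M : ℝ) * ‖α‖ ^ n := by
  rw [norm_mul, norm_pow]
  gcongr
  rw [Complex.norm_intCast]
  have := h ((n : ℤ) + k) (by omega)
  exact_mod_cast this

lemma rsummable {M k : ℤ} {c : ℤ → ℤ} {α : ℂ} (h1 : ‖α‖ < 1) (h : RBd M k c) :
    Summable (fun n : ℕ => (c ((n : ℤ) + k) : ℂ) * α ^ n) := by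
  refine Summable.of_norm_bounded (g := fun n : ℕ => (M : ℝ) * ‖α‖ ^ n) ?_ (rterm_bound α h)
  exact (summable_geometric_of_lt_one (norm_nonneg _) h1).mul_left _

lemma rval_norm_le {M k : ℤ} {c : ℤ → ℤ} {α : ℂ} (h1 : ‖α‖ < 1) (h : RBd M k c) :
    ‖rval α c k‖ ≤ (M : ℝ) * (1 - ‖α‖)⁻¹ := by
  refine tsum_of_norm_bounded (g := fun n : ℕ => (M : ℝ) * ‖α‖ ^ n) ?_ (rterm_bound α h)
  exact (hasSum_geometric_of_lt_one (norm_nonneg _) h1).mul_left _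

lemma rval_step {M k : ℤ} {c : ℤ → ℤ} {α : ℂ} (h1 : ‖α‖ < 1) (h : RBd M k c) :
    rval α c k = c k + α * rval α c (k + 1) := by
  unfold rval
  rw [(rsummable h1 h).tsum_eq_zero_add, ← tsum_mul_left]
  congr 1
  · simp
  · refine tsum_congr fun n => ?_
    rw [pow_succ]
    have : ((n + 1 : ℕ) : ℤ) + k = (n : ℤ) + (k + 1) := by push_cast; ring
    rw [this]; ring

lemma rval_congr {α : ℂ} {c d : ℤ → ℤ} {k l : ℤ} (h : ∀ n : ℕ, c ((n : ℤ) + k) = d ((n : ℤ) + l)) :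
    rval α c k = rval α d l := by
  unfold rval
  refine tsum_congr fun n => ?_
  rw [h]

lemma rval_sub {M N k : ℤ} {c d : ℤ → ℤ} {α : ℂ} (h1 : ‖α‖ < 1) (h : RBd M k c) (h' : RBd N k d) :
    rval α (fun i => d i - c i) k = rval α d k - rval α c k := by
  unfold rval
  rw [← (rsummable h1 h').tsum_sub (rsummable h1 h)]
  refine tsum_congr fun n => ?_
  push_cast; ring

lemma rval_neg {k : ℤ} {c : ℤ → ℤ} {α : ℂ} :
    rval α (fun i => - c i) k = - rval α c k := by
  unfold rval
  rw [← tsum_neg]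
  refine tsum_congr fun n => ?_
  push_cast; ring

/-- Numerical data attached to the root. -/
structure RData (a : ℤ) (α : ℂ) (b n t : ℝ) : Prop where
  ha : 3 ≤ a
  im : α.im ≠ 0
  root : α ^ 3 - (a : ℂ) * α ^ 2 + α - 1 = 0
  lt1 : ‖α‖ < 1
  bn : n * b = 1
  hb : 11 / 4 ≤ b
  n0 : 0 < n
  ht : t = n - n ^ 2
  hab : (a : ℝ) = b + t
  quad : α ^ 2 = t * α - n

lemma rdata_exists (a : ℤ) (ha : 3 ≤ a) (α : ℂ)
    (hroot : α ^ 3 - (a : ℂ) * α ^ 2 + α - 1 = 0) (hα : α.im ≠ 0) :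
    ∃ b n t, RData a α b n t := by
  obtain ⟨u, v⟩ := α
  simp only at hα
  have hre := congrArg Complex.re hroot
  have him := congrArg Complex.im hroot
  simp [pow_succ] at hre him
  have h1 : 3 * u ^ 2 - v ^ 2 - 2 * a * u + 1 = 0 := by
    have : v * (3 * u ^ 2 - v ^ 2 - 2 * a * u + 1) = 0 := by linear_combination him
    exact (mul_eq_zero.mp this).resolve_left hα
  have hn : 0 < u ^ 2 + v ^ 2 := by positivity
  have hbn : (u ^ 2 + v ^ 2) * (a - 2 * u) = 1 := by
    linear_combination hre - u * h1
  have hb0 : 0 < (a : ℝ) - 2 * u := by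
    by_contra h
    nlinarith
  have ht : 2 * u = (u ^ 2 + v ^ 2) - (u ^ 2 + v ^ 2) ^ 2 := by
    linear_combination (-2*u) * hbn - (u^2+v^2) * h1
  have ha' : (3 : ℝ) ≤ a := by exact_mod_cast ha
  have hb : 11 / 4 ≤ (a : ℝ) - 2 * u := by
    nlinarith [sq_nonneg (u ^ 2 + v ^ 2 - 1 / 2)]
  have hn1 : u ^ 2 + v ^ 2 < 1 := by nlinarith
  refine ⟨a - 2 * u, u ^ 2 + v ^ 2, 2 * u, ha, hα, hroot, ?_, hbn, hb, hn, ht, by ring, ?_⟩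
  · rw [← sq_lt_one_iff₀ (norm_nonneg _), ← Complex.normSq_eq_norm_sq, Complex.normSq_apply]
    simpa [sq] using hn1
  · apply Complex.ext <;> simp [pow_succ] <;> ring

lemma RData.ne0 {a : ℤ} {α : ℂ} {b n t : ℝ} (D : RData a α b n t) : α ≠ 0 := by
  intro h; apply D.im; rw [h]; simp

lemma RData.bound_aux {a : ℤ} {α : ℂ} {b n t : ℝ} (D : RData a α b n t) {e : ℤ → ℤ} {k : ℤ}
    (he : RBd (a - 1) k e) :
    (rval α e k).im / α.im = e (k + 1) + t * e (k + 2)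
      + (t ^ 2 - n) * ((rval α e (k + 2)).im / α.im) - n * t * ((rval α e (k + 3)).im / α.im) := by
  have e0 := rval_step D.lt1 he
  have e1 := rval_step D.lt1 (he.mono (show k ≤ k + 1 by omega))
  have e2 := rval_step D.lt1 (he.mono (show k ≤ k + 2 by omega))
  have r1 : k + 1 + 1 = k + 2 := by ring
  have r2 : k + 2 + 1 = k + 3 := by ring
  rw [r1] at e1
  rw [r2] at e2
  have key : rval α e k = e k + e (k + 1) * α + t * e (k + 2) * α
      + (t ^ 2 - n) * rval α e (k + 2) - n * t * rval α e (k + 3)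
      - t ^ 2 * e (k + 2)  := by
    linear_combination e0 + α * e1 + (rval α e (k+2) + 0) * D.quad + t * α * e2 +
      t * rval α e (k + 3) * D.quad - t ^ 2 * e2
  have him := congrArg Complex.im key
  have := D.im
  have c1 : ((t : ℂ) ^ 2 - n) = ((t ^ 2 - n : ℝ) : ℂ) := by push_cast; ring
  have c2 : ((n : ℂ) * t) = ((n * t : ℝ) : ℂ) := by push_cast; ring
  have c3 : ((t : ℂ) * e (k + 2)) = ((t * e (k + 2) : ℝ) : ℂ) := by push_cast; ring
  have c4 : ((t : ℂ) ^ 2 * e (k + 2)) = ((t ^ 2 * e (k + 2) : ℝ) : ℂ) := by push_cast; ring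
  rw [c4, c1, c2, c3] at him
  simp only [Complex.sub_im, Complex.add_im, Complex.ofReal_re, Complex.ofReal_im,
    Complex.intCast_im, Complex.mul_im, Complex.intCast_re] at him
  rw [him]
  field_simp
  ring

lemma RData.bound {a : ℤ} {α : ℂ} {b n t : ℝ} (D : RData a α b n t) {e : ℤ → ℤ} {k : ℤ}
    (he : RBd (a - 1) k e) : |(rval α e k).im / α.im| < 2 * b - 1 := by
  set S : Set ℝ := {r | ∃ (e : ℤ → ℤ) (k : ℤ), RBd (a - 1) k e ∧ r = |(rval α e k).im / α.im|}
  have hbdd : BddAbove S := by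
    refine ⟨(((a - 1 : ℤ) : ℝ) * (1 - ‖α‖)⁻¹) / |α.im|, ?_⟩
    rintro r ⟨e, k, h, rfl⟩
    rw [abs_div]
    gcongr
    exact (Complex.abs_im_le_norm _).trans (rval_norm_le D.lt1 h)
  have hn0 := D.n0
  have hbn := D.bn
  have hb := D.hb
  have hn1 : n ≤ 4 / 11 := by nlinarith
  have hnt : t = n * (1 - n) := by rw [D.ht]; ring
  have ht0 : 0 ≤ t := by rw [hnt]; apply mul_nonneg <;> linarith
  have htn : t ^ 2 ≤ n := by rw [hnt]; nlinarith [mul_nonneg hn0.le (sq_nonneg (1-n)), mul_pos hn0 hn0]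
  have hle : sSup S ≤ (a - 1) * (1 + t) + (n - t ^ 2 + n * t) * sSup S := by
    apply csSup_le
    · exact ⟨_, e, k, he, rfl⟩
    · rintro r ⟨e, k, h, rfl⟩
      have y2 : |(rval α e (k + 2)).im / α.im| ≤ sSup S :=
        le_csSup hbdd ⟨e, k + 2, h.mono (by omega), rfl⟩
      have y3 : |(rval α e (k + 3)).im / α.im| ≤ sSup S :=
        le_csSup hbdd ⟨e, k + 3, h.mono (by omega), rfl⟩
      have d1 : |(e (k + 1) : ℝ)| ≤ a - 1 := by exact_mod_cast h (k + 1) (by omega)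
      have d2 : |(e (k + 2) : ℝ)| ≤ a - 1 := by exact_mod_cast h (k + 2) (by omega)
      rw [D.bound_aux h]
      set Y2 := (rval α e (k + 2)).im / α.im
      set Y3 := (rval α e (k + 3)).im / α.im
      have m1 := mul_le_mul_of_nonneg_left d2 ht0
      have m2 := mul_le_mul_of_nonneg_left y2 (sub_nonneg.2 htn)
      have m3 := mul_le_mul_of_nonneg_left y3 (mul_nonneg hn0.le ht0)
      rw [← abs_of_nonneg ht0, ← abs_mul, abs_of_nonneg ht0] at m1
      rw [← abs_of_nonneg (sub_nonneg.2 htn), ← abs_mul, abs_of_nonneg (sub_nonneg.2 htn)] at m2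
      rw [← abs_of_nonneg (mul_nonneg hn0.le ht0), ← abs_mul,
        abs_of_nonneg (mul_nonneg hn0.le ht0)] at m3
      rw [abs_le] at *
      constructor <;> nlinarith
  have hab := D.hab
  have hM : n * ((a : ℝ) - 1) = (1 - n) * (1 + n ^ 2) := by
    rw [hab, hnt]; linear_combination hbn
  have hq : n - t ^ 2 + n * t = 1 - (1 - n) * (1 - n ^ 3) := by rw [hnt]; ring
  rw [hq] at hle
  have hmem : |(rval α e k).im / α.im| ≤ sSup S := le_csSup hbdd ⟨e, k, he, rfl⟩
  refine hmem.trans_lt ?_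
  have h2 : n * (sSup S) * (1 - n ^ 3) ≤ (1 + n ^ 2) * (1 + t) := by
    have h3 : (1 - n) * (n * (sSup S) * (1 - n ^ 3)) ≤ (1 - n) * ((1 + n ^ 2) * (1 + t)) := by
      nlinarith [mul_le_mul_of_nonneg_left hle hn0.le]
    exact le_of_mul_le_mul_left h3 (by linarith)
  have n2 : n ^ 2 ≤ 16 / 121 := by nlinarith
  have n3 : n ^ 3 ≤ 64 / 1331 := by nlinarith
  have n30 : 0 < n ^ 3 := by positivity
  have h4 : (1 + n ^ 2) * (1 + t) < (2 - n) * (1 - n ^ 3) := by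
    rw [hnt]; nlinarith
  have h5 : n * sSup S < 2 - n :=
    lt_of_mul_lt_mul_right (h2.trans_lt h4) (by linarith)
  have h6 : n * sSup S < n * (2 * b - 1) := by linarith
  exact lt_of_mul_lt_mul_left h6 hn0.le

lemma RData.inv {a : ℤ} {α : ℂ} {b n t : ℝ} (D : RData a α b n t) : α⁻¹ = b * (t - α) := by
  have h := D.ne0
  have hbn : (n : ℂ) * b = 1 := by exact_mod_cast D.bn
  field_simp
  linear_combination (-hbn) + b * D.quad

lemma RData.inv2 {a : ℤ} {α : ℂ} {b n t : ℝ} (D : RData a α b n t) :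
    (α⁻¹) ^ 2 = α - a + α⁻¹ := by
  have h := D.ne0
  field_simp
  linear_combination -D.root

lemma RData.inv3 {a : ℤ} {α : ℂ} {b n t : ℝ} (D : RData a α b n t) :
    (α⁻¹) ^ 3 = 1 - a * α⁻¹ + (α⁻¹) ^ 2 := by
  have h := D.ne0
  field_simp
  linear_combination -D.root

/-- If the value is `p + q α + r α⁻¹` with integers `p, q, r`, then `q - r b` is bounded. -/
lemma RData.bound' {a : ℤ} {α : ℂ} {b n t : ℝ} (D : RData a α b n t) {e : ℤ → ℤ} {k : ℤ}
    (he : RBd (a - 1) k e) (p q r : ℤ) (hv : rval α e k = p + q * α + r * α⁻¹) :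
    |(q : ℝ) - r * b| < 2 * b - 1 := by
  have h := D.bound he
  have h2 : (rval α e k).im / α.im = q - r * b := by
    rw [hv, D.inv]
    have := D.im
    simp
    field_simp
    ring
  rwa [h2] at h

lemma RData.next {a : ℤ} {α : ℂ} {b n t : ℝ} (D : RData a α b n t) {e : ℤ → ℤ} {k : ℤ}
    (he : RBd (a - 1) k e) : rval α e (k + 1) = (rval α e k - e k) * α⁻¹ := by
  have h := D.ne0
  rw [rval_step D.lt1 he]
  field_simp
  ring

lemma int_lt_of_mul {b : ℝ} (hb : 11 / 4 ≤ b) {m r : ℤ} (h : (m : ℝ) * b < r * b) : m < r := by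
  have : (m : ℝ) < r := lt_of_mul_lt_mul_right h (by linarith)
  exact_mod_cast this

lemma RData.first {a : ℤ} {α : ℂ} {b n t : ℝ} (D : RData a α b n t) {e : ℤ → ℤ} {k : ℤ}
    (he : RBd (a - 1) k e) (hv : rval α e k = α - a) :
    e k = -(a - 1) ∧ rval α e (k + 1) = 1 - α⁻¹ := by
  have h := D.ne0
  have hb := D.hb
  have h1 := D.next he
  have h2 : rval α e (k + 1) = ((1 : ℤ) : ℂ) + ((0 : ℤ) : ℂ) * α + ((-(a + e k) : ℤ) : ℂ) * α⁻¹ := by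
    rw [h1, hv]; push_cast; field_simp; ring
  have h3 := D.bound' (he.mono (by omega)) _ _ _ h2
  have hk := abs_le.1 (he k le_rfl)
  have h4 : a + e k < 2 := by
    apply int_lt_of_mul hb
    have := (abs_lt.1 h3).2
    push_cast at this ⊢
    linarith
  have h5 : e k = -(a - 1) := by omega
  refine ⟨h5, ?_⟩
  rw [h2, h5]; push_cast; ring

lemma RData.second {a : ℤ} {α : ℂ} {b n t : ℝ} (D : RData a α b n t) {e : ℤ → ℤ} {k : ℤ}
    (he : RBd (a - 1) k e) (hv : rval α e k = 1 - α⁻¹) :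
    (e k = 0 ∧ rval α e (k + 1) = a - α) ∨ (e k = 1 ∧ rval α e (k + 1) = - (α⁻¹) ^ 2) := by
  have h := D.ne0
  have hb := D.hb
  have h1 := D.next he
  have h2 : rval α e (k + 1) = (a : ℤ) + ((-1 : ℤ) : ℂ) * α + ((- e k : ℤ) : ℂ) * α⁻¹ := by
    rw [h1, hv]; push_cast; linear_combination - D.inv2
  have h3 := abs_lt.1 (D.bound' (he.mono (by omega)) _ _ _ h2)
  push_cast at h3
  have h4 : e k < 2 := by
    apply int_lt_of_mul hb
    push_cast
    linarith
  have h5 : -2 < e k := by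
    apply int_lt_of_mul hb
    push_cast
    linarith
  have h6 : e k ≠ -1 := by
    intro h6
    have h7 := D.next (he.mono (show k ≤ k + 1 by omega))
    have h8 : rval α e (k + 1 + 1) = ((-1 - a : ℤ) : ℂ) + ((1 : ℤ) : ℂ) * α
        + ((1 + a - e (k + 1) : ℤ) : ℂ) * α⁻¹ := by
      rw [h7, h2, h6]; push_cast
      linear_combination D.inv2 - mul_inv_cancel₀ h
    have h9 := abs_lt.1 (D.bound' (he.mono (by omega)) _ _ _ h8)
    push_cast at h9
    have hk := abs_le.1 (he (k + 1) (by omega))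
    have : 1 + a - e (k + 1) < 2 := by
      apply int_lt_of_mul hb
      push_cast
      linarith
    omega
  have : e k = 0 ∨ e k = 1 := by omega
  rcases this with h0 | h0
  · left; refine ⟨h0, ?_⟩; rw [h2, h0]; push_cast; ring
  · right; refine ⟨h0, ?_⟩; rw [h2, h0, D.inv2]; push_cast; ring

lemma RData.third {a : ℤ} {α : ℂ} {b n t : ℝ} (D : RData a α b n t) {e : ℤ → ℤ} {k : ℤ}
    (he : RBd (a - 1) k e) (hv : rval α e k = - (α⁻¹) ^ 2) :
    e k = a - 1 ∨ (e k = a - 2 ∧ rval α e (k + 1) = - (1 - α⁻¹) ^ 2) := by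
  have h := D.ne0
  have hb := D.hb
  have h1 := D.next he
  have h2 : rval α e (k + 1) = ((a - 1 : ℤ) : ℂ) + ((-1 : ℤ) : ℂ) * α
      + ((a - 1 - e k : ℤ) : ℂ) * α⁻¹ := by
    rw [h1, hv]; push_cast; linear_combination - D.inv2 - D.inv3
  have h3 := abs_lt.1 (D.bound' (he.mono (by omega)) _ _ _ h2)
  push_cast at h3
  have hk := abs_le.1 (he k le_rfl)
  have h4 : a - 1 - e k < 2 := by
    apply int_lt_of_mul hb
    push_cast
    linarith
  have : e k = a - 1 ∨ e k = a - 2 := by omega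
  rcases this with h0 | h0
  · left; exact h0
  · right; refine ⟨h0, ?_⟩; rw [h2, h0]; push_cast; linear_combination D.inv2

lemma RData.cyc {a : ℤ} {α : ℂ} {b n t : ℝ} (D : RData a α b n t) {e : ℤ → ℤ} {k : ℤ}
    (he : RBd (a - 1) k e) (hv : rval α e k = - (1 - α⁻¹) ^ 2) :
    e k = a - 1 ∧ e (k + 1) = -(a - 1) ∧ rval α e (k + 2) = (1 - α⁻¹) ^ 2 := by
  have h := D.ne0
  have hb := D.hb
  have h1 := D.next he
  have h2 : rval α e (k + 1) = ((-a - 1 : ℤ) : ℂ) + ((1 : ℤ) : ℂ) * α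
      + ((a - e k : ℤ) : ℂ) * α⁻¹ := by
    rw [h1, hv]; push_cast; linear_combination D.inv2 - D.inv3
  have h3 := abs_lt.1 (D.bound' (he.mono (by omega)) _ _ _ h2)
  push_cast at h3
  have hk := abs_le.1 (he k le_rfl)
  have h4 : a - e k < 2 := by
    apply int_lt_of_mul hb
    push_cast
    linarith
  have h5 : e k = a - 1 := by omega
  have h6 := D.next (he.mono (show k ≤ k + 1 by omega))
  rw [show k + 1 + 1 = k + 2 by ring] at h6
  have h7 : rval α e (k + 2) = ((1 - a : ℤ) : ℂ) + ((1 : ℤ) : ℂ) * α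
      + ((- (a + e (k + 1)) : ℤ) : ℂ) * α⁻¹ := by
    rw [h6, h2, h5]; push_cast; linear_combination D.inv2 + mul_inv_cancel₀ h
  have h8 := abs_lt.1 (D.bound' (he.mono (by omega)) _ _ _ h7)
  push_cast at h8
  have hk1 := abs_le.1 (he (k + 1) (by omega))
  have h9 : a + e (k + 1) < 2 := by
    apply int_lt_of_mul hb
    push_cast
    linarith
  have h10 : e (k + 1) = -(a - 1) := by omega
  refine ⟨h5, h10, ?_⟩
  rw [h7, h10]; push_cast; linear_combination - D.inv2

lemma RBd.neg {M k : ℤ} {c : ℤ → ℤ} (h : RBd M k c) : RBd M k (fun i => - c i) := by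
  intro i hi
  simpa using h i hi

lemma RData.cyc' {a : ℤ} {α : ℂ} {b n t : ℝ} (D : RData a α b n t) {e : ℤ → ℤ} {k : ℤ}
    (he : RBd (a - 1) k e) (hv : rval α e k = (1 - α⁻¹) ^ 2) :
    e k = -(a - 1) ∧ e (k + 1) = a - 1 ∧ rval α e (k + 2) = - (1 - α⁻¹) ^ 2 := by
  obtain ⟨h1, h2, h3⟩ := D.cyc he.neg (by rw [rval_neg, hv])
  rw [rval_neg] at h3
  refine ⟨by omega, by omega, by rw [← h3]; ring⟩

lemma RData.first' {a : ℤ} {α : ℂ} {b n t : ℝ} (D : RData a α b n t) {e : ℤ → ℤ} {k : ℤ}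
    (he : RBd (a - 1) k e) (hv : rval α e k = a - α) : e k = a - 1 := by
  obtain ⟨h1, -⟩ := D.first he.neg (by rw [rval_neg, hv]; ring)
  omega

lemma RData.cycAll {a : ℤ} {α : ℂ} {b n t : ℝ} (D : RData a α b n t) {e : ℤ → ℤ} (m : ℕ) :
    ∀ k : ℤ, RBd (a - 1) k e → 
    (rval α e k = - (1 - α⁻¹) ^ 2 ∨ rval α e k = (1 - α⁻¹) ^ 2) →
    (e (k + m) = a - 1 ∨ e (k + m) = -(a - 1)) ∧ e (k + m + 2) = - e (k + m) := by
  induction m using Nat.twoStepInduction with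
  | zero =>
    intro k he hv
    rcases hv with hv | hv
    · obtain ⟨h1, h2, h3⟩ := D.cyc he hv
      obtain ⟨h4, h5, h6⟩ := D.cyc' (he.mono (by omega)) h3
      simp [h1, h4]
    · obtain ⟨h1, h2, h3⟩ := D.cyc' he hv
      obtain ⟨h4, h5, h6⟩ := D.cyc (he.mono (by omega)) h3
      simp [h1, h4]
  | one =>
    intro k he hv
    have r : k + (1 : ℕ) + 2 = k + 2 + 1 := by push_cast; ring
    rw [r]
    rcases hv with hv | hv
    · obtain ⟨h1, h2, h3⟩ := D.cyc he hv
      obtain ⟨h4, h5, h6⟩ := D.cyc' (he.mono (by omega)) h3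
      simp [h2, h5]
    · obtain ⟨h1, h2, h3⟩ := D.cyc' he hv
      obtain ⟨h4, h5, h6⟩ := D.cyc (he.mono (by omega)) h3
      simp [h2, h5]
  | more m ih _ =>
    intro k he hv
    have r : k + ((m + 2 : ℕ) : ℤ) = k + 2 + m := by push_cast; ring
    rw [r]
    apply ih (k + 2) (he.mono (by omega))
    rcases hv with hv | hv
    · right; exact (D.cyc he hv).2.2
    · left; exact (D.cyc' he hv).2.2

/-- Digits in `[0, a-1]` from index `k` on. -/
def RDig (a k : ℤ) (c : ℤ → ℤ) : Prop := ∀ i, k ≤ i → 0 ≤ c i ∧ c i ≤ a - 1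

lemma RDig.bd {a k : ℤ} {c : ℤ → ℤ} (h : RDig a k c) : RBd (a - 1) k c := by
  intro i hi
  have := h i hi
  rw [abs_le]; omega

lemma RDig.mono {a k l : ℤ} {c : ℤ → ℤ} (h : RDig a k c) (hkl : k ≤ l) : RDig a l c :=
  fun i hi => h i (hkl.trans hi)

lemma RDig.sub {a k : ℤ} {c d : ℤ → ℤ} (hc : RDig a k c) (hd : RDig a k d) :
    RBd (a - 1) k (fun i => d i - c i) := by
  intro i hi
  have := hc i hi
  have := hd i hi
  rw [abs_le]; constructor <;> dsimp only <;> omega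

lemma RData.pair {a : ℤ} {α : ℂ} {b n t : ℝ} (D : RData a α b n t) {c d : ℤ → ℤ} {k : ℤ}
    (hc : RDig a k c) (hd : RDig a k d) (hv : rval α d k - rval α c k = α - a) :
    c k = a - 1 ∧ d k = 0 ∧
    ((d (k + 1) = c (k + 1) ∧ c (k + 2) = 0 ∧ d (k + 2) = a - 1 ∧
        rval α c (k + 2) - rval α d (k + 2) = α - a) ∨
     (d (k + 1) = c (k + 1) + 1 ∧ c (k + 2) = 0 ∧ d (k + 2) = a - 1) ∨
     (d (k + 1) = c (k + 1) + 1 ∧ d (k + 2) = c (k + 2) + a - 2 ∧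
        c (k + 3) = 0 ∧ c (k + 4) = a - 1 ∧ c (k + 5) = a - 1 ∧
        ∀ i, k + 3 ≤ i → c (i + 2) = a - 1 - c i)) := by
  have he := hc.sub hd
  have hs := rval_sub D.lt1 hc.bd hd.bd
  rw [hv] at hs
  obtain ⟨h0, h1⟩ := D.first he hs
  have hk := hc k le_rfl
  have hk' := hd k le_rfl
  refine ⟨by omega, by omega, ?_⟩
  have hk2 := hc (k + 2) (by omega)
  have hk2' := hd (k + 2) (by omega)
  rcases D.second (he.mono (by omega)) h1 with ⟨h2, h3⟩ | ⟨h2, h3⟩ <;>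
    rw [show k + 1 + 1 = k + 2 by ring] at h3
  · left
    have h4 := D.first' (he.mono (by omega)) h3
    refine ⟨by omega, by omega, by omega, ?_⟩
    rw [rval_sub D.lt1 (hc.mono (by omega)).bd (hd.mono (by omega)).bd] at h3
    linear_combination -h3
  · right
    rcases D.third (he.mono (by omega)) h3 with h4 | ⟨h4, h5⟩
    · left
      refine ⟨by omega, by omega, by omega⟩
    · right
      rw [show k + 2 + 1 = k + 3 by ring] at h5
      have h6 := D.cyc (he.mono (by omega)) h5
      obtain ⟨h7, h8, h9⟩ := h6
      have h10 := (D.cyc' (he.mono (by omega)) h9).1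
      rw [show k + 3 + 1 = k + 4 by ring] at h8
      rw [show k + 3 + 2 = k + 5 by ring] at h10
      have b3 := hc (k + 3) (by omega)
      have b3' := hd (k + 3) (by omega)
      have b4 := hc (k + 4) (by omega)
      have b4' := hd (k + 4) (by omega)
      have b5 := hc (k + 5) (by omega)
      have b5' := hd (k + 5) (by omega)
      refine ⟨by omega, by omega, by omega, by omega, by omega, ?_⟩
      intro i hi
      obtain ⟨m, hm⟩ := Int.eq_ofNat_of_zero_le (show 0 ≤ i - (k + 3) by omega)
      have h11 := D.cycAll m (k + 3) (he.mono (by omega)) (Or.inl h5)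
      have r : k + 3 + (m : ℤ) = i := by omega
      rw [r] at h11
      have g1 := hc i (by omega)
      have g2 := hd i (by omega)
      have g3 := hc (i + 2) (by omega)
      have g4 := hd (i + 2) (by omega)
      obtain ⟨h12 | h12, h13⟩ := h11 <;> omega

/-- A good pair of expansions witnessing membership in the boundary set. -/
structure RPair (a : ℤ) (α : ℂ) (c d : ℤ → ℤ) : Prop where
  hc : Admissible a 2 c
  hd : Admissible a 2 d
  hv : rval α d 2 - rval α c 2 = α - a

lemma rval_pow (α : ℂ) (c : ℤ → ℤ) (k : ℕ) :
    ∑' n : ℕ, (c ((n : ℤ) + k) : ℂ) * α ^ (n + k) = α ^ k * rval α c k := by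
  unfold rval
  rw [← tsum_mul_left]
  refine tsum_congr fun n => ?_
  rw [pow_add]; ring

lemma RData.mem_B {a : ℤ} {α : ℂ} {b n t : ℝ} (D : RData a α b n t) (z : ℂ) :
    z ∈ BSet a α (α - 1) ↔ ∃ c d, RPair a α c d ∧ z = α ^ 2 * rval α c 2 := by
  have h := D.ne0
  have hp := fun c => rval_pow α c 2
  push_cast at hp
  constructor
  · rintro ⟨⟨c, hc, hz⟩, ⟨w, ⟨d, hd, hw⟩, hwz⟩⟩
    rw [hp] at hz hw
    refine ⟨c, d, ⟨hc, hd, ?_⟩, hz⟩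
    simp only at hwz
    have h2 : α ^ 2 ≠ 0 := pow_ne_zero _ h
    apply mul_left_cancel₀ h2
    linear_combination hz - hw + hwz - D.root
  · rintro ⟨c, d, ⟨hc, hd, hv⟩, hz⟩
    refine ⟨⟨c, hc, by rw [hp]; exact hz⟩, ⟨α ^ 2 * rval α d 2, ⟨d, hd, by rw [hp]⟩, ?_⟩⟩
    simp only
    linear_combination α ^ 2 * hv - hz + D.root

lemma Admissible.dig {a k : ℤ} {c : ℤ → ℤ} (h : Admissible a k c) : RDig a k c := h.1

lemma wordLt_of_lt {a x y z w : ℤ} (h : x < a - 1) : WordLt a x y z w := Or.inl h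

lemma wordLt_iff {a x y z w : ℤ} (hx : 0 ≤ x ∧ x ≤ a - 1) (hy : 0 ≤ y ∧ y ≤ a - 1)
    (hz : 0 ≤ z ∧ z ≤ a - 1) (hw : 0 ≤ w ∧ w ≤ a - 1) :
    WordLt a x y z w ↔ ¬ (x = a - 1 ∧ y = a - 1 ∧ (z ≠ 0 ∨ w ≠ 0)) := by
  unfold WordLt; omega

/-- Admissibility in terms of forbidden patterns. -/
lemma admissible_iff {a k : ℤ} {c : ℤ → ℤ} :
    Admissible a k c ↔ RDig a k c ∧
      ∀ i, k + 3 ≤ i → ¬ (c i = a - 1 ∧ c (i - 1) = a - 1 ∧ (c (i - 2) ≠ 0 ∨ c (i - 3) ≠ 0)) := by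
  unfold Admissible
  refine and_congr_right fun h => forall_congr' fun i => imp_congr_right fun hi => ?_
  exact wordLt_iff (h _ (by omega)) (h _ (by omega)) (h _ (by omega)) (h _ (by omega))

lemma Admissible.bad {a k : ℤ} {c : ℤ → ℤ} (h : Admissible a k c) (i : ℤ) (hi : k + 3 ≤ i)
    (h1 : c i = a - 1) (h2 : c (i - 1) = a - 1) : c (i - 2) = 0 ∧ c (i - 3) = 0 := by
  have := (admissible_iff.1 h).2 i hi
  omega

/-- Sequence with three prescribed digits at `2,3,4` followed by `c` shifted by `s`. -/
def rcons (x y z s : ℤ) (c : ℤ → ℤ) : ℤ → ℤ :=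
  fun i => if i = 2 then x else if i = 3 then y else if i = 4 then z else c (i - s)

lemma rcons_two (x y z s : ℤ) (c : ℤ → ℤ) : rcons x y z s c 2 = x := by simp [rcons]
lemma rcons_three (x y z s : ℤ) (c : ℤ → ℤ) : rcons x y z s c 3 = y := by simp [rcons]
lemma rcons_four (x y z s : ℤ) (c : ℤ → ℤ) : rcons x y z s c 4 = z := by simp [rcons]
lemma rcons_ge (x y z s : ℤ) (c : ℤ → ℤ) {i : ℤ} (hi : 5 ≤ i) : rcons x y z s c i = c (i - s) := by
  unfold rcons
  rw [if_neg (by omega), if_neg (by omega), if_neg (by omega)]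

lemma rcons_adm {a x y z s : ℤ} {c : ℤ → ℤ} (hx : 0 ≤ x ∧ x ≤ a - 1) (hy : 0 ≤ y ∧ y ≤ a - 1)
    (hz : 0 ≤ z ∧ z ≤ a - 1) (hc : RDig a (5 - s) c)
    (h5 : ¬ (c (5 - s) = a - 1 ∧ z = a - 1 ∧ (y ≠ 0 ∨ x ≠ 0)))
    (h6 : ¬ (c (6 - s) = a - 1 ∧ c (5 - s) = a - 1 ∧ (z ≠ 0 ∨ y ≠ 0)))
    (h7 : ¬ (c (7 - s) = a - 1 ∧ c (6 - s) = a - 1 ∧ (c (5 - s) ≠ 0 ∨ z ≠ 0)))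
    (h8 : ∀ i, 8 - s ≤ i → 
      ¬ (c i = a - 1 ∧ c (i - 1) = a - 1 ∧ (c (i - 2) ≠ 0 ∨ c (i - 3) ≠ 0))) :
    Admissible a 2 (rcons x y z s c) := by
  rw [admissible_iff]
  constructor
  · intro i hi
    have : i = 2 ∨ i = 3 ∨ i = 4 ∨ 5 ≤ i := by omega
    rcases this with rfl | rfl | rfl | h
    · rwa [rcons_two]
    · rwa [rcons_three]
    · rwa [rcons_four]
    · rw [rcons_ge _ _ _ _ _ h]; exact hc _ (by omega)
  · intro i hi
    have : i = 5 ∨ i = 6 ∨ i = 7 ∨ 8 ≤ i := by omega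
    rcases this with rfl | rfl | rfl | h
    · norm_num only [rcons_two, rcons_three, rcons_four]
      rwa [rcons_ge _ _ _ _ _ (by norm_num)]
    · norm_num only [rcons_two, rcons_three, rcons_four]
      rwa [rcons_ge _ _ _ _ _ (by norm_num), rcons_ge _ _ _ _ _ (by norm_num)]
    · norm_num only [rcons_two, rcons_three, rcons_four]
      rwa [rcons_ge _ _ _ _ _ (by norm_num), rcons_ge _ _ _ _ _ (by norm_num),
        rcons_ge _ _ _ _ _ (by norm_num)]
    · rw [rcons_ge _ _ _ _ _ (by omega), rcons_ge _ _ _ _ _ (by omega),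
        rcons_ge _ _ _ _ _ (by omega), rcons_ge _ _ _ _ _ (by omega)]
      have := h8 (i - s) (by omega)
      rwa [show i - 1 - s = i - s - 1 by ring, show i - 2 - s = i - s - 2 by ring,
        show i - 3 - s = i - s - 3 by ring]

lemma rval_three {M : ℤ} {c : ℤ → ℤ} {α : ℂ} (h1 : ‖α‖ < 1) (h : RBd M 2 c) :
    rval α c 2 = c 2 + c 3 * α + c 4 * α ^ 2 + α ^ 3 * rval α c 5 := by
  rw [rval_step h1 h, rval_step h1 (h.mono (show (2 : ℤ) ≤ 2 + 1 by omega)),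
    rval_step h1 (h.mono (show (2 : ℤ) ≤ 2 + 1 + 1 by omega))]
  norm_num only
  ring

lemma rval_two {M : ℤ} {c : ℤ → ℤ} {α : ℂ} (h1 : ‖α‖ < 1) (h : RBd M 2 c) :
    rval α c 2 = c 2 + c 3 * α + α ^ 2 * rval α c 4 := by
  rw [rval_step h1 h, rval_step h1 (h.mono (show (2 : ℤ) ≤ 2 + 1 by omega))]
  norm_num only
  ring

lemma rcons_val {a x y z s : ℤ} {c : ℤ → ℤ} {α : ℂ} (h1 : ‖α‖ < 1) 
    (h : Admissible a 2 (rcons x y z s c)) :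
    rval α (rcons x y z s c) 2 = x + y * α + z * α ^ 2 + α ^ 3 * rval α c (5 - s) := by
  rw [rval_three h1 h.dig.bd, rcons_two, rcons_three, rcons_four]
  congr 2
  apply rval_congr
  intro n
  rw [rcons_ge _ _ _ _ _ (by omega)]
  congr 1; ring

/-- Normal pairs. -/
structure RNormal (a : ℤ) (α : ℂ) (c d : ℤ → ℤ) : Prop extends RPair a α c d where
  c2 : c 2 = a - 1
  d2 : d 2 = 0
  c4 : c 4 = 0
  d4 : d 4 = a - 1
  cd : (d 3 = c 3 ∧ rval α c 4 - rval α d 4 = α - a) ∨ d 3 = c 3 + 1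

lemma RData.normal {a : ℤ} {α : ℂ} {b n t : ℝ} (D : RData a α b n t) {c d : ℤ → ℤ}
    (P : RPair a α c d) :
    RNormal a α c d ∨ (∃ d', RNormal a α c d' ∧ d' 3 = c 3 ∧ d 3 = c 3 + 1) := by
  have ha := D.ha
  have h := D.pair P.hc.dig P.hd.dig P.hv
  norm_num only at h
  obtain ⟨c2, d2, ⟨h3, c4, d4, hv⟩ | ⟨h3, c4, d4⟩ | ⟨h3, h4, c5, c6, c7, hper⟩⟩ := h
  · left; exact ⟨P, c2, d2, c4, d4, Or.inl ⟨h3, hv⟩⟩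
  · left; exact ⟨P, c2, d2, c4, d4, Or.inr h3⟩
  · right
    have c4 : c 4 = 0 := by
      have := P.hc.bad 7 (by norm_num) c7 (by norm_num only; exact c6)
      norm_num only at this
      exact this.2
    have hdig := P.hc.dig
    have hbad := (admissible_iff.1 P.hc).2
    have hA : Admissible a 2 (rcons 0 (c 3) (a - 1) 1 c) := by
      apply rcons_adm
      · omega
      · exact hdig 3 (by norm_num)
      · omega
      · exact hdig.mono (by norm_num)
      · norm_num only; omega
      · norm_num only; omega
      · norm_num only; omega
      · intro i hi; exact hbad i (by omega)
    have hval := rcons_val D.lt1 hA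
    norm_num only at hval
    -- compute the periodic tail
    set P4 := rval α c 4 with hP4
    have t4 := rval_step D.lt1 (hdig.mono (show (2 : ℤ) ≤ 4 by omega)).bd
    have t5 := rval_step D.lt1 (hdig.mono (show (2 : ℤ) ≤ 5 by omega)).bd
    norm_num only at t4 t5
    rw [← hP4, c4] at t4
    rw [c5] at t5
    have hgeo : rval α c 6 = (a - 1) * (1 - α)⁻¹ - P4 := by
      rw [← tsum_geometric_of_norm_lt_one D.lt1, ← tsum_mul_left, hP4]
      unfold rval
      rw [← ((summable_geometric_of_norm_lt_one D.lt1).mul_left _).tsum_sub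
        (rsummable D.lt1 (hdig.mono (show (2 : ℤ) ≤ 4 by omega)).bd)]
      refine tsum_congr fun m => ?_
      have : c ((m : ℤ) + 6) = a - 1 - c ((m : ℤ) + 4) := by
        rcases Nat.eq_zero_or_pos m with rfl | hm
        · norm_num; omega
        · rw [← hper _ (by omega)]; congr 1
      rw [this]; push_cast; ring
    have h1α : 1 - α ≠ 0 := by
      intro h0
      apply D.im
      have : α = 1 := by linear_combination -h0
      rw [this]; simp
    have hPeq : P4 * (1 - α) * (1 + α ^ 2) = α ^ 2 * (a - 1) := by
      rw [t5, hgeo] at t4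
      field_simp at t4
      push_cast at t4
      linear_combination t4
    have hq : (1 : ℂ) + α ^ 2 ≠ 0 := by
      intro h0
      have hq1 : ‖α ^ 2‖ < 1 := by
        rw [norm_pow]; exact pow_lt_one₀ (norm_nonneg _) D.lt1 (by norm_num)
      have : α ^ 2 = -1 := by linear_combination h0
      rw [this] at hq1
      simp at hq1
    have hv2 : rval α (rcons 0 (c 3) (a - 1) 1 c) 2 - rval α c 2 = α - a := by
      rw [hval, rval_two D.lt1 hdig.bd, c2, ← hP4]
      apply mul_right_cancel₀ hq
      push_cast
      linear_combination (-α ^ 2) * hPeq - D.root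
    have hv4 : rval α c 4 - rval α (rcons 0 (c 3) (a - 1) 1 c) 4 = α - a := by
      have e1 := rval_two D.lt1 hA.dig.bd
      have e2 := rval_two D.lt1 hdig.bd
      rw [rcons_two, rcons_three] at e1
      rw [c2] at e2
      apply mul_left_cancel₀ (pow_ne_zero 2 D.ne0)
      push_cast at e1 e2
      linear_combination e1 - e2 - hv2 - D.root
    refine ⟨_, ⟨⟨P.hc, hA, hv2⟩, c2, rcons_two _ _ _ _ _, c4, rcons_four _ _ _ _ _, 
      Or.inl ⟨rcons_three _ _ _ _ _, hv4⟩⟩, rcons_three _ _ _ _ _, h3⟩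

lemma Admissible.shift {a k s : ℤ} {c : ℤ → ℤ} (h : Admissible a k c) (hs : 0 ≤ s) :
    Admissible a k (fun i => c (i + s)) := by
  rw [admissible_iff] at *
  refine ⟨fun i hi => h.1 (i + s) (by omega), fun i hi => ?_⟩
  have := h.2 (i + s) (by omega)
  rwa [show i - 1 + s = i + s - 1 by ring, show i - 2 + s = i + s - 2 by ring,
    show i - 3 + s = i + s - 3 by ring]

lemma rval_shift (α : ℂ) (c : ℤ → ℤ) (k s : ℤ) :
    rval α (fun i => c (i + s)) k = rval α c (k + s) := by
  apply rval_congr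
  intro n
  congr 1; ring

lemma RData.exists_normal {a : ℤ} {α : ℂ} {b n t : ℝ} (D : RData a α b n t) {z : ℂ}
    (hz : z ∈ BSet a α (α - 1)) : ∃ c d, RNormal a α c d ∧ z = α ^ 2 * rval α c 2 := by
  obtain ⟨c, d, P, h⟩ := (D.mem_B z).1 hz
  rcases D.normal P with N | ⟨d', N, -⟩
  · exact ⟨c, d, N, h⟩
  · exact ⟨c, d', N, h⟩

lemma RData.sub_left {a : ℤ} {α : ℂ} {b n t : ℝ} (D : RData a α b n t) {z : ℂ}
    (hz : z ∈ BSet a α (α - 1)) :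
    (∃ k ∈ Set.Icc (0 : ℤ) (a - 2), z ∈ gOdd α k '' BSet a α (α - 1)) ∨
    (∃ k ∈ Set.Icc (0 : ℤ) (a - 2), z ∈ gEven a α k '' Bprime a α) ∨
    z ∈ gEven a α (a - 1) '' BSet a α (α - 1) := by
  have ha := D.ha
  obtain ⟨c, d, N, hz⟩ := D.exists_normal hz
  have hzd : z = α - 1 + α ^ 2 * rval α d 2 := by
    linear_combination hz - α ^ 2 * N.hv - D.root
  have cb := N.hc.dig
  have db := N.hd.dig
  have c3 := cb 3 (by norm_num)
  have d3 := db 3 (by norm_num)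
  rcases N.cd with ⟨h3, hv4⟩ | h3
  · -- even case
    right
    set C : ℤ → ℤ := fun i => d (i + 2) with hC
    set E : ℤ → ℤ := fun i => c (i + 2) with hE
    have hCv : rval α C 2 = rval α d 4 := rval_shift α d 2 2
    have hEv : rval α E 2 = rval α c 4 := rval_shift α c 2 2
    have PP : RPair a α C E :=
      ⟨N.hd.shift (by norm_num), N.hc.shift (by norm_num), by rw [hCv, hEv]; exact hv4⟩
    have hw : α ^ 2 * rval α C 2 ∈ BSet a α (α - 1) := (D.mem_B _).2 ⟨C, E, PP, rfl⟩
    have hg : gEven a α (a - 1 - d 3) (α ^ 2 * rval α C 2) = z := by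
      rw [hzd, rval_two D.lt1 db.bd, N.d2, hCv]
      unfold gEven
      push_cast
      ring
    by_cases hd0 : d 3 = 0
    · right
      rw [hd0, sub_zero] at hg
      exact ⟨_, hw, hg⟩
    · left
      refine ⟨a - 1 - d 3, ⟨by omega, by omega⟩, _, ⟨hw, ?_⟩, hg⟩
      have key : ∀ E' : ℤ → ℤ, RPair a α C E' → E' 2 = 0 → E' 3 ≠ a - 1 →
          ∃ c : ℤ → ℤ, Admissible a 3 c ∧ c 3 ≠ a - 1 ∧
          α ^ 2 * rval α C 2 = α - 1 + ∑' n : ℕ, (c ((n : ℤ) + 3) : ℂ) * α ^ (n + 3) := by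
        intro E' P' h2 h3
        refine ⟨E', ⟨fun i hi => P'.hd.1 i (by omega), fun i hi => P'.hd.2 i (by omega)⟩, h3, ?_⟩
        have := rval_pow α E' 3
        push_cast at this
        rw [this]
        have e1 := rval_step D.lt1 P'.hd.dig.bd
        rw [h2] at e1
        norm_num only at e1
        linear_combination -α ^ 2 * P'.hv - D.root + α ^ 2 * e1
      rcases D.normal PP with N' | ⟨E', N', h1, h2⟩
      · refine key E PP N'.d2 ?_
        intro h5
        have h6 := N'.d4
        have := N.hc.bad 6 (by norm_num) h6 (by norm_num only; exact h5)
        norm_num only at this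
        omega
      · refine key E' N'.toRPair N'.d2 ?_
        have := PP.hd.dig 3 (by norm_num)
        omega
  · -- odd case
    left
    have d5 : d 5 ≠ a - 1 := by
      intro h5
      have := N.hd.bad 5 (by norm_num) h5 (by norm_num only; exact N.d4)
      norm_num only at this
      omega
    set C : ℤ → ℤ := fun i => if i = 2 then d 5 + 1 else d (i + 3) with hC
    set E : ℤ → ℤ := fun i => c (i + 3) with hE
    have hC2 : C 2 = d 5 + 1 := by simp [hC]
    have hCge : ∀ i, 3 ≤ i → C i = d (i + 3) := by
      intro i hi; simp only [hC]; rw [if_neg (by omega)]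
    have hEv : rval α E 2 = rval α c 5 := rval_shift α c 2 3
    have Cdig : RDig a 2 C := by
      intro i hi
      rcases eq_or_lt_of_le hi with rfl | h
      · rw [hC2]; have := db 5 (by norm_num); omega
      · rw [hCge i (by omega)]; exact db _ (by omega)
    have hCv : rval α C 2 = rval α d 5 + 1 := by
      rw [rval_step D.lt1 Cdig.bd, hC2,
        rval_step D.lt1 (db.mono (show (2 : ℤ) ≤ 5 by norm_num)).bd,
        rval_congr (c := C) (d := d) (k := 2 + 1) (l := 5 + 1)]
      · push_cast; ring
      · intro n; rw [hCge _ (by omega)]; congr 1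
    have Eadm : Admissible a 2 E := N.hc.shift (by norm_num)
    have e1 := rval_three D.lt1 cb.bd
    have e2 := rval_three D.lt1 db.bd
    rw [N.c2, N.c4] at e1
    rw [N.d2, N.d4, h3] at e2
    push_cast at e1 e2
    have hv : rval α E 2 - rval α C 2 = α - a := by
      rw [hEv, hCv]
      apply mul_left_cancel₀ (pow_ne_zero 3 D.ne0)
      linear_combination e2 - e1 - N.hv - (α + 1) * D.root
    have hp := D.pair Cdig Eadm.dig hv
    norm_num only at hp
    have C4 : C 4 ≠ a - 1 := by
      obtain ⟨-, -, h | h | h⟩ := hp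
      · omega
      · omega
      · have := Eadm.dig 4 (by norm_num)
        omega
    have Cadm : Admissible a 2 C := by
      rw [admissible_iff]
      refine ⟨Cdig, fun i hi => ?_⟩
      rcases eq_or_lt_of_le hi with rfl | h
      · norm_num only; tauto
      · have := (admissible_iff.1 N.hd).2 (i + 3) (by omega)
        rw [hCge i (by omega), hCge (i - 1) (by omega), hCge (i - 2) (by omega),
          hCge (i - 3) (by omega)]
        rwa [show i - 1 + 3 = i + 3 - 1 by ring, show i - 2 + 3 = i + 3 - 2 by ring,
          show i - 3 + 3 = i + 3 - 3 by ring]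
    refine ⟨a - 1 - d 3, ⟨by omega, by omega⟩, _, (D.mem_B _).2 ⟨C, E, ⟨Cadm, Eadm, hv⟩, rfl⟩, ?_⟩
    rw [hzd, e2, hCv, h3]
    unfold gOdd
    push_cast
    linear_combination (α ^ 2 + α) * D.root

lemma RData.even_mem {a : ℤ} {α : ℂ} {b n t : ℝ} (D : RData a α b n t) {c d : ℤ → ℤ}
    (P : RPair a α c d) (c2 : c 2 = a - 1) (d2 : d 2 = 0) (c4 : c 4 = 0) {k : ℤ}
    (hk : 0 ≤ k ∧ k ≤ a - 1) (hk' : k = a - 1 ∨ (c 3 ≠ a - 1 ∧ d 3 ≠ a - 1)) :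
    gEven a α k (α ^ 2 * rval α c 2) ∈ BSet a α (α - 1) := by
  have ha := D.ha
  have cb := P.hc.dig
  have db := P.hd.dig
  have hcb := (admissible_iff.1 P.hc).2
  have hdb := (admissible_iff.1 P.hd).2
  have A1 : Admissible a 2 (rcons (a - 1) (a - 1 - k) 0 2 d) := by
    apply rcons_adm
    · omega
    · omega
    · omega
    · exact db.mono (by norm_num)
    · omega
    · norm_num only; grind
    · have := hdb 5 (by norm_num)
      norm_num only at this ⊢
      grind
    · intro i hi; exact hdb i (by omega)
  have A2 : Admissible a 2 (rcons 0 (a - 1 - k) (a - 1) 2 c) := by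
    apply rcons_adm
    · omega
    · omega
    · omega
    · exact cb.mono (by norm_num)
    · norm_num only; grind
    · norm_num only; grind
    · norm_num only; grind
    · intro i hi; exact hcb i (by omega)
  have v1 := rcons_val D.lt1 A1
  have v2 := rcons_val D.lt1 A2
  have e1 := rval_step D.lt1 cb.bd
  have e2 := rval_step D.lt1 db.bd
  rw [c2] at e1
  rw [d2] at e2
  norm_num only at v1 v2 e1 e2
  push_cast at v1 v2 e1 e2
  have hv := P.hv
  refine (D.mem_B _).2 ⟨_, _, ⟨A1, A2, ?_⟩, ?_⟩
  · rw [v1, v2]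
    linear_combination (-α ^ 2) * e1 + α ^ 2 * e2 - α ^ 2 * hv - D.root
  · rw [v1]
    unfold gEven
    linear_combination α ^ 4 * e2 - α ^ 4 * hv + (1 - α ^ 2) * D.root

lemma RData.odd_mem {a : ℤ} {α : ℂ} {b n t : ℝ} (D : RData a α b n t) {c d : ℤ → ℤ}
    (P : RNormal a α c d) {k : ℤ} (hk : 0 ≤ k ∧ k ≤ a - 2) :
    gOdd α k (α ^ 2 * rval α c 2) ∈ BSet a α (α - 1) := by
  have ha := D.ha
  have cb := P.hc.dig
  have db := P.hd.dig
  have hcb := (admissible_iff.1 P.hc).2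
  have hdb := (admissible_iff.1 P.hd).2
  have c2 := P.c2
  have c4 := P.c4
  have d2 := P.d2
  set c' : ℤ → ℤ := fun i => if i = 2 then a - 2 else c i with hc'
  have hc2 : c' 2 = a - 2 := by simp [hc']
  have hcge : ∀ i, 3 ≤ i → c' i = c i := by
    intro i hi; simp only [hc']; rw [if_neg (by omega)]
  have c'b : RDig a 2 c' := by
    intro i hi
    rcases eq_or_lt_of_le hi with rfl | h
    · rw [hc2]; omega
    · rw [hcge i (by omega)]; exact cb _ (by omega)
  have A1 : Admissible a 2 (rcons (a - 1) (a - 2 - k) 0 3 d) := by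
    apply rcons_adm
    · omega
    · omega
    · omega
    · exact db.mono (by norm_num)
    · omega
    · norm_num only; grind
    · norm_num only; grind
    · intro i hi; exact hdb i (by omega)
  have A2 : Admissible a 2 (rcons 0 (a - 1 - k) (a - 1) 3 c') := by
    apply rcons_adm
    · omega
    · omega
    · omega
    · exact c'b.mono (by norm_num)
    · norm_num only; grind
    · norm_num only; grind
    · norm_num only; rw [hcge 4 (by norm_num)]; omega
    · intro i hi
      have : i = 5 ∨ 6 ≤ i := by omega
      rcases this with rfl | h
      · norm_num only; rw [hcge 4 (by norm_num)]; omega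
      · rw [hcge _ (by omega), hcge _ (by omega), hcge _ (by omega), hcge _ (by omega)]
        exact hcb i (by omega)
  have v1 := rcons_val D.lt1 A1
  have v2 := rcons_val D.lt1 A2
  have e1 := rval_step D.lt1 cb.bd
  have e3 := rval_step D.lt1 c'b.bd
  rw [c2] at e1
  rw [hc2, rval_congr (c := c') (d := c) (k := 2 + 1) (l := 2 + 1)
    (fun n => hcge _ (by omega))] at e3
  norm_num only at v1 v2 e1 e3
  push_cast at v1 v2 e1 e3
  have hv := P.hv
  refine (D.mem_B _).2 ⟨_, _, ⟨A1, A2, ?_⟩, ?_⟩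
  · rw [v1, v2]
    linear_combination (-α ^ 3) * e1 + α ^ 3 * e3 - α ^ 3 * hv - (1 + α) * D.root
  · rw [v1]
    unfold gOdd
    linear_combination (-α ^ 5) * hv + (-α^3 + α + 1) * D.root

lemma RData.bprime_mem {a : ℤ} {α : ℂ} {b n t : ℝ} (D : RData a α b n t) {w : ℂ}
    (hw : w ∈ Bprime a α) {k : ℤ} (hk : 0 ≤ k ∧ k ≤ a - 2) :
    gEven a α k w ∈ BSet a α (α - 1) := by
  have ha := D.ha
  obtain ⟨hB, e, he, he3, hwe⟩ := hw
  obtain ⟨c, d, N, rfl⟩ := D.exists_normal hB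
  have cb := N.hc.dig
  have db := N.hd.dig
  have hc3 := cb 3 (by norm_num)
  have hd3 := db 3 (by norm_num)
  by_cases hd : d 3 = a - 1
  · -- use the other expansion
    have := rval_pow α e 3
    push_cast at this
    rw [this] at hwe
    set E : ℤ → ℤ := fun i => if i = 2 then 0 else e i with hE
    have hE2 : E 2 = 0 := by simp [hE]
    have hEge : ∀ i, 3 ≤ i → E i = e i := by
      intro i hi; simp only [hE]; rw [if_neg (by omega)]
    have Eb : RDig a 2 E := by
      intro i hi
      rcases eq_or_lt_of_le hi with rfl | h
      · rw [hE2]; omega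
      · rw [hEge i (by omega)]; exact he.dig _ (by omega)
    have Ev : rval α E 2 = α * rval α e 3 := by
      rw [rval_step D.lt1 Eb.bd, hE2, rval_congr (c := E) (d := e) (k := 2 + 1) (l := 2 + 1)
        (fun n => hEge _ (by omega))]
      norm_num
    have hv : rval α E 2 - rval α c 2 = α - a := by
      apply mul_left_cancel₀ (pow_ne_zero 2 D.ne0)
      rw [Ev]
      linear_combination -hwe - D.root
    have hp := D.pair cb Eb hv
    norm_num only at hp
    have h33 := hEge 3 (by norm_num)
    have hcd : d 3 = c 3 ∨ d 3 = c 3 + 1 := by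
      rcases N.cd with h | h
      · exact Or.inl h.1
      · exact Or.inr h
    have he3' := he.dig 3 (by norm_num)
    have c3 : c 3 = a - 2 := by
      obtain ⟨-, -, h | h | h⟩ := hp <;> omega
    obtain ⟨-, -, h | h | h⟩ := hp
    · obtain ⟨h1, h2, h3, h4⟩ := h
      have E5 : E 5 ≠ a - 1 := by
        intro E5
        have hq := D.pair (Eb.mono (show (2 : ℤ) ≤ 4 by norm_num))
          (cb.mono (show (2 : ℤ) ≤ 4 by norm_num)) h4
        norm_num only at hq
        have c5 := cb 5 (by norm_num)
        obtain ⟨-, -, h | h | h⟩ := hq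
        · have := N.hc.bad 6 (by norm_num) h.2.2.1 (by norm_num only; omega)
          norm_num only at this
          omega
        · omega
        · omega
      have EA : Admissible a 2 E := by
        rw [admissible_iff]
        refine ⟨Eb, fun i hi => ?_⟩
        rcases eq_or_lt_of_le hi with rfl | h
        · norm_num only; tauto
        · rw [hEge _ (by omega), hEge _ (by omega), hEge _ (by omega), hEge _ (by omega)]
          exact (admissible_iff.1 he).2 i (by omega)
      exact D.even_mem ⟨N.hc, EA, hv⟩ N.c2 hE2 N.c4 (by omega) (Or.inr ⟨by omega, by omega⟩)
    · omega
    · omega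
  · refine D.even_mem N.toRPair N.c2 N.d2 N.c4 (by omega) (Or.inr ⟨?_, hd⟩)
    rcases N.cd with h | h <;> omega

theorem bset_decomposition (a : ℤ) (ha : 3 ≤ a) (α : ℂ)
    (hroot : α ^ 3 - (a : ℂ) * α ^ 2 + α - 1 = 0) (hα : α.im ≠ 0) :
    BSet a α (α - 1) =
      (⋃ k ∈ Set.Icc (0 : ℤ) (a - 2), gOdd α k '' BSet a α (α - 1)) ∪
      (⋃ k ∈ Set.Icc (0 : ℤ) (a - 2), gEven a α k '' Bprime a α) ∪
      gEven a α (a - 1) '' BSet a α (α - 1) := by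

  obtain ⟨b, n, t, D⟩ := rdata_exists a ha α hroot hα
  apply Set.Subset.antisymm
  · intro z hz
    rcases D.sub_left hz with ⟨k, hk, h⟩ | ⟨k, hk, h⟩ | h
    · left; left
      exact Set.mem_biUnion hk h
    · left; right
      exact Set.mem_biUnion hk h
    · right; exact h
  · rintro z ((h | h) | h)
    · obtain ⟨k, hk, w, hw, rfl⟩ := Set.mem_iUnion₂.1 h
      obtain ⟨c, d, N, rfl⟩ := D.exists_normal hw
      exact D.odd_mem N ⟨hk.1, hk.2⟩
    · obtain ⟨k, hk, w, hw, rfl⟩ := Set.mem_iUnion₂.1 h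
      exact D.bprime_mem hw ⟨hk.1, hk.2⟩
    · obtain ⟨w, hw, rfl⟩ := h
      obtain ⟨c, d, N, rfl⟩ := D.exists_normal hw
      exact D.even_mem N.toRPair N.c2 N.d2 N.c4 (by omega) (Or.inl rfl)
end
end

section
/- Let k₁, k₂ be integers with 0 ≤ k₁ ≤ k₂ ≤ a-2. If k₂ > k₁ then g_{2k₁}(B'_{α-1}) ∩ g_{2k₂+1}(B_{α-1}) = ∅, while if k₂ = k₁ = k then g_{2k}(B'_{α-1}) ∩ g_{2k+1}(B_{α-1}) = { -1 - α² - k·α³ - (a-1)·α⁴ }. -/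
open Complex Filter Topology

noncomputable section

/-- The power series with digits `x`. -/
def VV (α : ℂ) (x : ℕ → ℤ) : ℂ := ∑' n : ℕ, (x n : ℂ) * α ^ n

/-- Digit bound. -/
def Bd (a : ℤ) (x : ℕ → ℤ) : Prop := ∀ n, |x n| ≤ a - 1

/-- The parameters `r = |α|²`, `t = 2 Re α`, and what we know about them. -/
structure Par (a : ℤ) (α : ℂ) (r t : ℝ) : Prop where
  ha : (3 : ℤ) ≤ a
  root : α ^ 3 - (a : ℂ) * α ^ 2 + α - 1 = 0
  hr : r = Complex.normSq α
  hre : t = 2 * α.re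
  r0 : 0 < r
  r1 : r < 37 / 100
  ht : t = r * (1 - r)
  har : (a : ℝ) * r = 1 + r ^ 2 * (1 - r)
  quad : α ^ 2 = t * α - r

lemma exists_par (a : ℤ) (ha : 3 ≤ a) (α : ℂ)
    (hroot : α ^ 3 - (a : ℂ) * α ^ 2 + α - 1 = 0) (hα : α.im ≠ 0) :
    ∃ r t : ℝ, Par a α r t := by
  have haR : (3 : ℝ) ≤ a := by exact_mod_cast ha
  have quad : α ^ 2 = ((2 * α.re : ℝ) : ℂ) * α - ((Complex.normSq α : ℝ) : ℂ) := by
    apply Complex.ext <;> simp [Complex.normSq_apply, pow_two] <;> ring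
  obtain ⟨t, ht⟩ : ∃ t : ℝ, t = 2 * α.re := ⟨_, rfl⟩
  obtain ⟨r, hr⟩ : ∃ r : ℝ, r = Complex.normSq α := ⟨_, rfl⟩
  rw [← ht, ← hr] at quad
  have hlin : (((t ^ 2 - r - a * t + 1 : ℝ)) : ℂ) * α + ((-t * r + a * r - 1 : ℝ) : ℂ) = 0 := by
    push_cast
    linear_combination hroot - (α + t - a) * quad
  have him := congrArg Complex.im hlin
  have hre := congrArg Complex.re hlin
  simp only [Complex.add_im, Complex.add_re, Complex.re_ofReal_mul, Complex.im_ofReal_mul,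
    Complex.ofReal_re, Complex.ofReal_im, Complex.zero_re, Complex.zero_im, add_zero] at him hre
  have e1 : t ^ 2 - r - a * t + 1 = 0 := by
    rcases mul_eq_zero.1 him with h | h
    · exact h
    · exact absurd h hα
  rw [e1] at hre
  have r0 : 0 < r := by
    rw [hr]; apply Complex.normSq_pos.2
    rintro rfl; simp at hα
  have e2 : r * (a - t) = 1 := by linarith
  have e3 : t = r * (1 - r) := by linear_combination (-t) * e2 - r * e1
  have e4 : (a : ℝ) * r = 1 + r ^ 2 * (1 - r) := by
    linear_combination e2 + r * e3
  refine ⟨r, t, ha, hroot, hr, ht, r0, ?_, e3, e4, quad⟩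
  by_contra hc
  push Not at hc
  nlinarith [mul_nonneg r0.le (sub_nonneg.2 haR), mul_nonneg r0.le (sub_nonneg.2 hc),
    mul_nonneg (mul_nonneg r0.le r0.le) (sub_nonneg.2 hc), sq_nonneg (r - 1), sq_nonneg r]

section
variable {a : ℤ} {α : ℂ} {r t : ℝ}

lemma Par.norm_sq (P : Par a α r t) : ‖α‖ ^ 2 = r := by
  rw [P.hr, Complex.normSq_eq_norm_sq]

lemma Par.norm_lt (P : Par a α r t) : ‖α‖ < 1 := by
  have := P.norm_sq
  have := P.r1
  nlinarith [norm_nonneg α]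

lemma Par.ne (P : Par a α r t) : α ≠ 0 := by
  rintro rfl
  have := P.r0
  simp [P.hr] at this

/-- norm of `A + B α`. -/
lemma Par.nsq (P : Par a α r t) (A B : ℝ) :
    ‖(A : ℂ) + B * α‖ ^ 2 = A ^ 2 + A * B * t + B ^ 2 * r := by
  rw [← Complex.normSq_eq_norm_sq, P.hr, P.hre, Complex.normSq_apply, Complex.normSq_apply]
  simp
  ring

lemma Par.summable (P : Par a α r t) {x : ℕ → ℤ} (hx : Bd a x) :
    Summable (fun n : ℕ => (x n : ℂ) * α ^ n) := by
  apply Summable.of_norm_bounded (g := fun n => ((a : ℝ) - 1) * ‖α‖ ^ n)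
  · exact (summable_geometric_of_lt_one (norm_nonneg _) P.norm_lt).mul_left _
  · intro n
    rw [norm_mul, norm_pow, Complex.norm_intCast]
    have : |(x n : ℝ)| ≤ a - 1 := by exact_mod_cast hx n
    gcongr

lemma Par.bound0 (P : Par a α r t) {x : ℕ → ℤ} (hx : Bd a x) :
    ‖VV α x‖ ≤ ((a : ℝ) - 1) * (1 - ‖α‖)⁻¹ := by
  apply tsum_of_norm_bounded (g := fun n => ((a : ℝ) - 1) * ‖α‖ ^ n)
  · exact (hasSum_geometric_of_lt_one (norm_nonneg _) P.norm_lt).mul_left _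
  · intro n
    rw [norm_mul, norm_pow, Complex.norm_intCast]
    have : |(x n : ℝ)| ≤ a - 1 := by exact_mod_cast hx n
    gcongr

lemma Bd.succ {x : ℕ → ℤ} (hx : Bd a x) : Bd a (fun n => x (n + 1)) := fun _ => hx _

lemma Par.V_succ (P : Par a α r t) {x : ℕ → ℤ} (hx : Bd a x) :
    VV α x = x 0 + α * VV α (fun n => x (n + 1)) := by
  unfold VV
  rw [(P.summable hx).tsum_eq_zero_add, ← tsum_mul_left]
  simp only [pow_zero, mul_one]
  congr 1
  apply tsum_congr
  intro n
  ring

lemma Par.pair (P : Par a α r t) {x y : ℤ} (hx : |x| ≤ a - 1) (hy : |y| ≤ a - 1) :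
    ‖(x : ℂ) + y * α‖ ≤ ((a : ℝ) - 1) * √(1 + t + r) := by
  have h := P.nsq x y
  push_cast at h
  have haR : (3 : ℝ) ≤ a := by exact_mod_cast P.ha
  have hx' : |(x : ℝ)| ≤ a - 1 := by exact_mod_cast hx
  have hy' : |(y : ℝ)| ≤ a - 1 := by exact_mod_cast hy
  have r0 := P.r0
  have t0 : 0 ≤ t := by rw [P.ht]; have := P.r1; nlinarith
  refine (sq_le_sq₀ (norm_nonneg _) (by apply mul_nonneg _ (Real.sqrt_nonneg _); linarith)).1 ?_
  · rw [h, mul_pow, Real.sq_sqrt (by positivity)]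
    have h1 : (x : ℝ) ^ 2 ≤ (a - 1) ^ 2 := sq_le_sq' (by linarith [(abs_le.1 hx').1]) (abs_le.1 hx').2
    have h2 : (y : ℝ) ^ 2 ≤ (a - 1) ^ 2 := sq_le_sq' (by linarith [(abs_le.1 hy').1]) (abs_le.1 hy').2
    have h3 : (x : ℝ) * y ≤ (a - 1) ^ 2 := by nlinarith [sq_nonneg ((x : ℝ) - y)]
    nlinarith

lemma Par.bound1 (P : Par a α r t) (n : ℕ) : ∀ {x : ℕ → ℤ}, Bd a x →
    ‖VV α x‖ ≤ ((a : ℝ) - 1) * √(1 + t + r) / (1 - r) + r ^ n * (((a : ℝ) - 1) * (1 - ‖α‖)⁻¹) := by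
  have haR : (3 : ℝ) ≤ a := by exact_mod_cast P.ha
  have r1 : 0 < 1 - r := by linarith [P.r1]
  have r0 := P.r0
  induction n with
  | zero =>
    intro x hx
    have := P.bound0 hx
    have : 0 ≤ ((a : ℝ) - 1) * √(1 + t + r) / (1 - r) :=
      div_nonneg (mul_nonneg (by linarith) (Real.sqrt_nonneg _)) r1.le
    simp only [pow_zero, one_mul]
    linarith
  | succ n ih =>
    intro x hx
    have e : VV α x = ((x 0 : ℂ) + x 1 * α) + α ^ 2 * VV α (fun n => x (n + 1 + 1)) := by
      rw [P.V_succ hx, P.V_succ hx.succ]; ring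
    have h1 := ih hx.succ.succ
    have h2 := P.pair (hx 0) (hx 1)
    rw [e]
    refine (norm_add_le _ _).trans ?_
    rw [norm_mul, norm_pow, P.norm_sq]
    have h3 := mul_le_mul_of_nonneg_left h1 r0.le
    have h4 : ((a : ℝ) - 1) * √(1 + t + r) / (1 - r) =
      ((a : ℝ) - 1) * √(1 + t + r) + r * (((a : ℝ) - 1) * √(1 + t + r) / (1 - r)) := by
      field_simp; ring
    rw [h4, pow_succ]
    linarith

lemma Par.bound (P : Par a α r t) {x : ℕ → ℤ} (hx : Bd a x) :
    ‖VV α x‖ ≤ ((a : ℝ) - 1) * √(1 + t + r) / (1 - r) := by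
  have h : Tendsto (fun n : ℕ => ((a : ℝ) - 1) * √(1 + t + r) / (1 - r) +
      r ^ n * (((a : ℝ) - 1) * (1 - ‖α‖)⁻¹)) atTop
      (𝓝 (((a : ℝ) - 1) * √(1 + t + r) / (1 - r) + 0 * (((a : ℝ) - 1) * (1 - ‖α‖)⁻¹))) :=
    ((tendsto_pow_atTop_nhds_zero_of_lt_one P.r0.le (by linarith [P.r1])).mul_const _).const_add _
  rw [zero_mul, add_zero] at h
  exact ge_of_tendsto' h (fun n => P.bound1 n hx)

lemma Par.state (P : Par a α r t) {x : ℕ → ℤ} (hx : Bd a x) {T : ℂ}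
    (hT : T + α ^ 2 * VV α x = 0) :
    ‖T‖ ^ 2 ≤ (1 + r ^ 2) ^ 2 * (1 + 2 * r - r ^ 2) := by
  have e : T = -(α ^ 2 * VV α x) := by linear_combination hT
  have r1 : 0 < 1 - r := by linarith [P.r1]
  have r0 := P.r0
  have t0 : 0 ≤ t := by rw [P.ht]; positivity
  have h1 : ‖T‖ ≤ (1 + r ^ 2) * √(1 + t + r) := by
    rw [e, norm_neg, norm_mul, norm_pow, P.norm_sq]
    refine (mul_le_mul_of_nonneg_left (P.bound hx) r0.le).trans_eq ?_
    rw [mul_div_assoc', div_eq_iff r1.ne']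
    linear_combination √(1 + t + r) * P.har
  calc ‖T‖ ^ 2 ≤ ((1 + r ^ 2) * √(1 + t + r)) ^ 2 := by gcongr
    _ = (1 + r ^ 2) ^ 2 * (1 + 2 * r - r ^ 2) := by
      rw [mul_pow, Real.sq_sqrt (by positivity), P.ht]; ring

lemma Par.state' (P : Par a α r t) {x : ℕ → ℤ} (hx : Bd a x) {T : ℂ} (A B : ℝ)
    (hT : T + α ^ 2 * VV α x = 0) (hAB : T = A + B * α) :
    A ^ 2 + A * B * t + B ^ 2 * r ≤ (1 + r ^ 2) ^ 2 * (1 + 2 * r - r ^ 2) := by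
  have := P.state hx hT
  rwa [hAB, P.nsq] at this

lemma Par.next (P : Par a α r t) {x : ℕ → ℤ} (hx : Bd a x) {T : ℂ} (T' : ℂ)
    (hT : T + α ^ 2 * VV α x = 0) (h : α * T' = T + x 0 * α ^ 2) :
    T' + α ^ 2 * VV α (fun n => x (n + 1)) = 0 := by
  rw [P.V_succ hx] at hT
  apply mul_left_cancel₀ P.ne
  linear_combination hT + h

lemma Par.m_le (P : Par a α r t) {x : ℕ → ℤ} (hx : Bd a x) {m : ℤ}
    (hm : 2 ≤ m) (hT : (m : ℂ) + α ^ 2 * VV α x = 0) : False := by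
  have h := P.state' hx m 0 hT (by push_cast; ring)
  have hm' : (2 : ℝ) ≤ m := by exact_mod_cast hm
  have r0 := P.r0
  have r1 := P.r1
  have h1 : r ^ 2 ≤ 1 / 4 := by nlinarith
  have h2 : (1 + r ^ 2) ^ 2 ≤ 2 := by nlinarith [sq_nonneg r]
  have h3 : 1 + 2 * r - r ^ 2 ≤ 7 / 4 := by nlinarith
  have h4 : (1 + r ^ 2) ^ 2 * (1 + 2 * r - r ^ 2) ≤ 2 * (7 / 4) := by
    apply mul_le_mul h2 h3 <;> nlinarith
  nlinarith

/-- The state `1 - jα + α²` needs `j < 3`. -/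
lemma Par.excl1 (P : Par a α r t) {x : ℕ → ℤ} (hx : Bd a x) {j : ℤ}
    (hT : (1 - j * α + α ^ 2) + α ^ 2 * VV α x = 0) : j < 3 := by
  by_contra hj
  push Not at hj
  have hj' : (3 : ℝ) ≤ j := by exact_mod_cast hj
  have h := P.state' hx (1 - r) (t - j) hT (by push_cast; linear_combination P.quad)
  have r0 := P.r0
  have r1 := P.r1
  obtain ⟨J, hJ⟩ : ∃ J : ℝ, J = j - t := ⟨_, rfl⟩
  have hJ3 : 3 - r * (1 - r) ≤ J := by rw [hJ, ← P.ht]; linarith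
  have e : (1 - r) ^ 2 - r * ((1 - r) ^ 2 * J - J ^ 2) ≤
    (1 + r ^ 2) ^ 2 * (1 + 2 * r - r ^ 2) := by
    refine le_trans (le_of_eq ?_) h
    rw [show t - (j : ℝ) = -J by rw [hJ]; ring, P.ht]; ring
  have hlow : (3 - r * (1 - r)) * ((3 - r * (1 - r)) - (1 - r) ^ 2) ≤ J * (J - (1 - r) ^ 2) := by
    apply mul_le_mul hJ3 (by linarith) <;> nlinarith
  have h5 := mul_le_mul_of_nonneg_left hlow r0.le
  have key : (1 + r ^ 2) ^ 2 * (1 + 2 * r - r ^ 2) <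
    (1 - r) ^ 2 + r * ((3 - r * (1 - r)) * ((3 - r * (1 - r)) - (1 - r) ^ 2)) := by
    have q2 : r * r ≤ 37 / 100 * r := by nlinarith
    have q3 : r ^ 3 ≤ 37 / 100 * (37 / 100 * r) := by nlinarith
    have q4 : 0 < r ^ 4 := by positivity
    have q5 : r ^ 5 ≤ 37 / 100 * (37 / 100 * r) := by nlinarith [pow_pos r0 3, pow_pos r0 4]
    have q6 : 0 < r ^ 6 := by positivity
    nlinarith [sq_nonneg r]
  linarith

/-- The state `1 + iα - α²` needs `i < 1`. -/
lemma Par.excl2 (P : Par a α r t) {x : ℕ → ℤ} (hx : Bd a x) {i : ℤ}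
    (hT : (-1 - i * α + α ^ 2) + α ^ 2 * VV α x = 0) : i < 1 := by
  by_contra hj
  push Not at hj
  have hj' : (1 : ℝ) ≤ i := by exact_mod_cast hj
  have h := P.state' hx (-1 - r) (t - i) hT (by push_cast; linear_combination P.quad)
  have r0 := P.r0
  have r1 := P.r1
  obtain ⟨J, hJ⟩ : ∃ J : ℝ, J = i - t := ⟨_, rfl⟩
  have hJ3 : 1 - r * (1 - r) ≤ J := by rw [hJ, ← P.ht]; linarith
  have e : (1 + r) ^ 2 + r * ((1 - r ^ 2) * J + J ^ 2) ≤
    (1 + r ^ 2) ^ 2 * (1 + 2 * r - r ^ 2) := by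
    refine le_trans (le_of_eq ?_) h
    rw [show t - (i : ℝ) = -J by rw [hJ]; ring, P.ht]; ring
  have hlow : (1 - r * (1 - r)) * ((1 - r * (1 - r)) + (1 - r ^ 2)) ≤ J * (J + (1 - r ^ 2)) := by
    apply mul_le_mul hJ3 (by linarith) <;> nlinarith
  have h5 := mul_le_mul_of_nonneg_left hlow r0.le
  have key : (1 + r ^ 2) ^ 2 * (1 + 2 * r - r ^ 2) <
    (1 + r) ^ 2 + r * ((1 - r * (1 - r)) * ((1 - r * (1 - r)) + (1 - r ^ 2))) := by
    have q2 : r * r ≤ 37 / 100 * r := by nlinarith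
    have q3 : r ^ 3 ≤ 37 / 100 * (37 / 100 * r) := by nlinarith
    have q4 : 0 < r ^ 4 := by positivity
    have q5 : r ^ 5 ≤ 37 / 100 * (37 / 100 * r) := by nlinarith [pow_pos r0 3, pow_pos r0 4]
    have q6 : 0 < r ^ 6 := by positivity
    nlinarith [sq_nonneg r]
  linarith

lemma Par.P1 (P : Par a α r t) {x : ℕ → ℤ} (hx : Bd a x) (h0 : x 0 ≤ a - 2)
    (hT : 1 + α ^ 2 * VV α x = 0) :
    x 0 = a - 2 ∧ (1 - α) ^ 2 + α ^ 2 * VV α (fun n => x (n + 1)) = 0 := by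
  have h := P.next hx (1 - ((a - x 0 : ℤ) : ℂ) * α + α ^ 2) hT
    (by push_cast; linear_combination P.root)
  have h1 := P.excl1 hx.succ h
  have h2 : x 0 = a - 2 := by omega
  refine ⟨h2, ?_⟩
  rw [h2] at h
  push_cast at h
  linear_combination h

lemma Par.P2 (P : Par a α r t) {x : ℕ → ℤ} (hx : Bd a x)
    (hT : (1 - α) ^ 2 + α ^ 2 * VV α x = 0) :
    x 0 = a - 1 ∧ (α ^ 2 - 1) + α ^ 2 * VV α (fun n => x (n + 1)) = 0 := by
  have h := P.next hx (-1 - ((a - 1 - x 0 : ℤ) : ℂ) * α + α ^ 2) hT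
    (by push_cast; linear_combination P.root)
  have h1 := P.excl2 hx.succ h
  have h2 : x 0 = a - 1 := by have := (abs_le.1 (hx 0)).2; omega
  refine ⟨h2, ?_⟩
  rw [h2] at h
  push_cast at h
  linear_combination h

lemma VV_neg (x : ℕ → ℤ) : VV α (fun n => - x n) = - VV α x := by
  unfold VV
  rw [← tsum_neg]
  apply tsum_congr
  intro n
  push_cast
  ring

lemma Bd.neg {x : ℕ → ℤ} (hx : Bd a x) : Bd a (fun n => - x n) := fun n => by
  rw [abs_neg]; exact hx n

lemma Par.P3 (P : Par a α r t) {x : ℕ → ℤ} (hx : Bd a x)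
    (hT : (α ^ 2 - 1) + α ^ 2 * VV α x = 0) :
    x 0 = -(a - 1) ∧ -(1 - α) ^ 2 + α ^ 2 * VV α (fun n => x (n + 1)) = 0 := by
  have h := P.next hx (-(1 - ((a + 1 + x 0 : ℤ) : ℂ) * α + α ^ 2)) hT
    (by push_cast; linear_combination -P.root)
  have h' : (1 - ((a + 1 + x 0 : ℤ) : ℂ) * α + α ^ 2) +
      α ^ 2 * VV α (fun n => - x (n + 1)) = 0 := by
    rw [VV_neg (fun n => x (n + 1))]; linear_combination -h
  have h1 := P.excl1 hx.succ.neg h'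
  have h2 : x 0 = -(a - 1) := by have := (abs_le.1 (hx 0)).1; omega
  refine ⟨h2, ?_⟩
  rw [h2] at h
  push_cast at h
  linear_combination h

lemma Par.P2n (P : Par a α r t) {x : ℕ → ℤ} (hx : Bd a x)
    (hT : -(1 - α) ^ 2 + α ^ 2 * VV α x = 0) :
    x 0 = -(a - 1) ∧ (1 - α ^ 2) + α ^ 2 * VV α (fun n => x (n + 1)) = 0 := by
  obtain ⟨h1, h2⟩ := P.P2 hx.neg (by rw [VV_neg]; linear_combination -hT)
  rw [VV_neg (fun n => x (n + 1))] at h2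
  exact ⟨by omega, by linear_combination -h2⟩

lemma Par.P3n (P : Par a α r t) {x : ℕ → ℤ} (hx : Bd a x)
    (hT : (1 - α ^ 2) + α ^ 2 * VV α x = 0) :
    x 0 = a - 1 ∧ (1 - α) ^ 2 + α ^ 2 * VV α (fun n => x (n + 1)) = 0 := by
  obtain ⟨h1, h2⟩ := P.P3 hx.neg (by rw [VV_neg]; linear_combination -hT)
  rw [VV_neg (fun n => x (n + 1))] at h2
  exact ⟨by omega, by linear_combination -h2⟩

/-- One turn around the cycle. -/
lemma Par.cycle (P : Par a α r t) {x : ℕ → ℤ} (hx : Bd a x)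
    (hT : (1 - α) ^ 2 + α ^ 2 * VV α x = 0) :
    x 0 = a - 1 ∧ x 1 = -(a - 1) ∧ x 2 = -(a - 1) ∧ x 3 = a - 1 ∧
      (1 - α) ^ 2 + α ^ 2 * VV α (fun n => x (n + 4)) = 0 := by
  obtain ⟨h0, H0⟩ := P.P2 hx hT
  obtain ⟨h1, H1⟩ := P.P3 hx.succ H0
  obtain ⟨h2, H2⟩ := P.P2n hx.succ.succ H1
  obtain ⟨h3, H3⟩ := P.P3n hx.succ.succ.succ H2
  exact ⟨h0, h1, h2, h3, H3⟩

lemma Par.cycles (P : Par a α r t) {x : ℕ → ℤ} (hx : Bd a x)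
    (hT : (1 - α) ^ 2 + α ^ 2 * VV α x = 0) (m : ℕ) :
    (1 - α) ^ 2 + α ^ 2 * VV α (fun n => x (n + 4 * m)) = 0 := by
  induction m with
  | zero => exact hT
  | succ m ih =>
    have := (P.cycle (x := fun n => x (n + 4 * m)) (fun n => hx _) ih).2.2.2.2
    have e : (fun n => x (n + 4 * (m + 1))) = fun n => x (n + 4 + 4 * m) := by
      funext n; congr 1; ring
    rw [e]; exact this

/-- The periodic expansion of `-1`. -/
def pp (a : ℤ) (n : ℕ) : ℤ := if n % 4 < 2 then 0 else a - 1

lemma pp_add (n : ℕ) : pp a (n + 4) = pp a n := by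
  unfold pp; rw [Nat.add_mod_right]

lemma pp0 : pp a 0 = 0 := by simp [pp]
lemma pp1 : pp a 1 = 0 := by simp [pp]
lemma pp2 : pp a 2 = a - 1 := by simp [pp]
lemma pp3 : pp a 3 = a - 1 := by simp [pp]

lemma pp_range (ha : 3 ≤ a) (n : ℕ) : 0 ≤ pp a n ∧ pp a n ≤ a - 1 := by
  unfold pp; split_ifs <;> omega

lemma bd_of_range {x : ℕ → ℤ} (hx : ∀ n, 0 ≤ x n ∧ x n ≤ a - 1) : Bd a x := fun n =>
  abs_le.2 ⟨by have := hx n; omega, (hx n).2⟩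

lemma Par.V_pp (P : Par a α r t) : VV α (pp a) = -1 := by
  have hb : Bd a (pp a) := bd_of_range (pp_range P.ha)
  have h := P.V_succ hb
  rw [P.V_succ hb.succ, P.V_succ hb.succ.succ, P.V_succ hb.succ.succ.succ] at h
  simp only [zero_add, Nat.reduceAdd, add_assoc, pp_add, pp0, pp1, pp2, pp3] at h
  have h4 : 1 - α ^ 4 ≠ 0 := by
    intro h0
    have h1 : α ^ 4 = 1 := by linear_combination -h0
    have h2 : ‖α‖ ^ 4 = 1 := by rw [← norm_pow, h1, norm_one]
    have h3 : ‖α‖ ^ 4 = r ^ 2 := by rw [← P.norm_sq]; ring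
    have := P.r0
    have := P.r1
    nlinarith
  apply mul_left_cancel₀ h4
  have h' : VV α (pp a) = ((a : ℂ) - 1) * (α ^ 2 + α ^ 3) + α ^ 4 * VV α (pp a) := by
    push_cast at h
    linear_combination h
  linear_combination h' - (1 + α) * P.root

lemma VV_sub (P : Par a α r t) {c f : ℕ → ℤ} (hc : Bd a c) (hf : Bd a f) :
    VV α (fun n => c n - f n) = VV α c - VV α f := by
  unfold VV
  rw [← (P.summable hc).tsum_sub (P.summable hf)]
  apply tsum_congr
  intro n
  push_cast
  ring

lemma Par.unique (P : Par a α r t) {c f : ℕ → ℤ} (hc : ∀ n, 0 ≤ c n ∧ c n ≤ a - 1)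
    (hf : ∀ n, 0 ≤ f n ∧ f n ≤ a - 1) (hc0 : c 0 ≠ a - 1) {m : ℤ} (hm : 1 ≤ m)
    (h : (m : ℂ) + α ^ 2 * (VV α c - VV α f) = 0) : m = 1 ∧ VV α f = -1 := by
  rw [← VV_sub P (bd_of_range hc) (bd_of_range hf)] at h
  have hx : Bd a (fun n => c n - f n) := fun n =>
    abs_le.2 ⟨by have := hc n; have := hf n; change _ ≤ c n - f n; omega,
      by have := hc n; have := hf n; change c n - f n ≤ _; omega⟩
  have hm1 : m = 1 := by
    by_contra hne
    exact P.m_le hx (by omega) h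
  refine ⟨hm1, ?_⟩
  subst hm1
  rw [Int.cast_one] at h
  have hc0' := hc 0
  have hf0' := hf 0
  obtain ⟨h0, H⟩ := P.P1 hx (by change c 0 - f 0 ≤ _; omega) h
  change c 0 - f 0 = _ at h0
  have hcyc := P.cycles hx.succ H
  rw [← P.V_pp]
  congr 1
  funext n
  rcases Nat.eq_zero_or_pos n with rfl | hn
  · rw [pp0]; omega
  · obtain ⟨d, hd⟩ : ∃ d, d = (n - 1) / 4 := ⟨_, rfl⟩
    have hk := P.cycle (fun n => hx _) (hcyc d)
    obtain ⟨k0, k1, k2, k3, -⟩ := hk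
    have hfn := hf n
    have hcn := hc n
    have hq : n = 0 + 4 * d + 1 ∨ n = 1 + 4 * d + 1 ∨ n = 2 + 4 * d + 1 ∨ n = 3 + 4 * d + 1 := by
      omega
    unfold pp
    rcases hq with e | e | e | e
    · rw [← e] at k0; change c n - f n = _ at k0; rw [if_pos (by omega)]; omega
    · rw [← e] at k1; change c n - f n = _ at k1; rw [if_neg (by omega)]; omega
    · rw [← e] at k2; change c n - f n = _ at k2; rw [if_neg (by omega)]; omega
    · rw [← e] at k3; change c n - f n = _ at k3; rw [if_pos (by omega)]; omega

lemma sum2 (c : ℤ → ℤ) : ∑' n : ℕ, (c ((n : ℤ) + 2) : ℂ) * α ^ (n + 2) =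
    α ^ 2 * VV α (fun n => c (n + 2)) := by
  unfold VV
  rw [← tsum_mul_left]
  apply tsum_congr
  intro n
  ring

lemma sum3 (c : ℤ → ℤ) : ∑' n : ℕ, (c ((n : ℤ) + 3) : ℂ) * α ^ (n + 3) =
    α ^ 3 * VV α (fun n => c (n + 3)) := by
  unfold VV
  rw [← tsum_mul_left]
  apply tsum_congr
  intro n
  ring

/-- A sequence starting with prescribed digits `u, v, w` and then periodic with phase `s`. -/
def pre3 (a : ℤ) (s : ℕ) (u v w : ℤ) (n : ℕ) : ℤ :=
  match n with
  | 0 => u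
  | 1 => v
  | 2 => w
  | n + 3 => pp a (n + s)

/-- Conditions making `pre3` admissible. -/
def Good (a : ℤ) (s : ℕ) (u v w : ℤ) : Prop :=
  (0 ≤ u ∧ u ≤ a - 1) ∧ (0 ≤ v ∧ v ≤ a - 1) ∧ (0 ≤ w ∧ w ≤ a - 1) ∧
  (s = 0 ∨ (s = 1 ∧ w = 0) ∨ (s = 2 ∧ w = 0 ∧ v = 0) ∨ (s = 3 ∧ w = a - 1 ∧ v = 0 ∧ u = 0))

/-- The value of the periodic tail, times `α ^ 3`. -/
def tailv (a : ℤ) (α : ℂ) (s : ℕ) : ℂ :=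
  match s with
  | 0 => -α ^ 3
  | 1 => -α ^ 2
  | 2 => -α
  | _ => -1 - (a - 1) * α ^ 2

lemma pre3_range (ha : 3 ≤ a) {s : ℕ} {u v w : ℤ} (h : Good a s u v w) (n : ℕ) :
    0 ≤ pre3 a s u v w n ∧ pre3 a s u v w n ≤ a - 1 := by
  match n with
  | 0 => exact h.1
  | 1 => exact h.2.1
  | 2 => exact h.2.2.1
  | n + 3 => exact pp_range ha _

lemma Par.V_tail (P : Par a α r t) {s : ℕ} (hs : s ≤ 3) :
    α ^ 3 * VV α (fun n => pp a (n + s)) = tailv a α s := by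
  have hb : Bd a (pp a) := bd_of_range (pp_range P.ha)
  have h0 := P.V_pp
  have h1 := P.V_succ hb
  have h2 := P.V_succ hb.succ
  have h3 := P.V_succ hb.succ.succ
  simp only [zero_add, Nat.reduceAdd, add_assoc, pp0, pp1, pp2] at h1 h2 h3
  push_cast at h1 h2 h3
  rw [h0] at h1
  interval_cases s
  · simp only [add_zero, tailv]
    change α ^ 3 * VV α (pp a) = _
    rw [h0]; ring
  · simp only [tailv]; linear_combination (-α ^ 2) * h1
  · simp only [tailv]; linear_combination (-α ^ 2) * h2 - α * h1
  · simp only [tailv]; linear_combination (-α ^ 2) * h3 - α * h2 - h1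

lemma Good.le {s : ℕ} {u v w : ℤ} (h : Good a s u v w) : s ≤ 3 := by
  obtain ⟨-, -, -, h⟩ := h
  omega

lemma Par.V_pre3 (P : Par a α r t) {s : ℕ} {u v w : ℤ} (h : Good a s u v w) :
    VV α (pre3 a s u v w) = u + v * α + w * α ^ 2 + tailv a α s := by
  have hb : Bd a (pre3 a s u v w) := bd_of_range (pre3_range P.ha h)
  rw [P.V_succ hb, P.V_succ hb.succ, P.V_succ hb.succ.succ, ← P.V_tail h.le]
  have : (fun n => pre3 a s u v w (n + 1 + 1 + 1)) = fun n => pp a (n + s) := rfl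
  rw [this]
  simp only [pre3]
  ring

lemma pre3_adm (ha : 3 ≤ a) {s : ℕ} {u v w : ℤ} (h : Good a s u v w) (k : ℤ) :
    Admissible a k (fun i => pre3 a s u v w (i - k).toNat) := by
  constructor
  · intro i _
    exact pre3_range ha h _
  · intro i hi
    obtain ⟨n, rfl⟩ : ∃ n : ℕ, i = k + 3 + n := ⟨(i - (k + 3)).toNat, by omega⟩
    have e0 : (k + 3 + (n : ℤ) - k).toNat = n + 3 := by omega
    have e1 : (k + 3 + (n : ℤ) - 1 - k).toNat = n + 2 := by omega
    have e2 : (k + 3 + (n : ℤ) - 2 - k).toNat = n + 1 := by omega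
    have e3 : (k + 3 + (n : ℤ) - 3 - k).toNat = n := by omega
    simp only [e0, e1, e2, e3]
    obtain ⟨hu, hv, hw, hs⟩ := h
    match n with
    | 0 => simp only [pre3, pp, WordLt]; split_ifs <;> omega
    | 1 => simp only [pre3, pp, WordLt]; split_ifs <;> omega
    | 2 => simp only [pre3, pp, WordLt]; split_ifs <;> omega
    | m + 3 => simp only [pre3, pp, WordLt]; split_ifs <;> omega

lemma pre3_shift (s : ℕ) (u v w k : ℤ) :
    (fun n : ℕ => pre3 a s u v w ((n : ℤ) + k - k).toNat) = pre3 a s u v w := by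
  funext n; congr 1; omega

lemma Par.mem_rauzy (P : Par a α r t) (s : ℕ) (u v w : ℤ) (h : Good a s u v w) {z : ℂ}
    (hz : z = α ^ 2 * (u + v * α + w * α ^ 2 + tailv a α s)) : z ∈ Rauzy a α := by
  refine ⟨_, pre3_adm P.ha h 2, ?_⟩
  rw [sum2 (fun i => pre3 a s u v w (i - 2).toNat), hz, pre3_shift, P.V_pre3 h]

end

theorem g_even_odd_inter (a : ℤ) (ha : 3 ≤ a) (α : ℂ)
    (hroot : α ^ 3 - (a : ℂ) * α ^ 2 + α - 1 = 0) (hα : α.im ≠ 0)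
    (k₁ k₂ : ℤ) (hk₁ : 0 ≤ k₁) (hk₁₂ : k₁ ≤ k₂) (hk₂ : k₂ ≤ a - 2) :
    (k₁ < k₂ → gEven a α k₁ '' Bprime a α ∩ gOdd α k₂ '' BSet a α (α - 1) = ∅) ∧
    (k₁ = k₂ → gEven a α k₁ '' Bprime a α ∩ gOdd α k₂ '' BSet a α (α - 1) =
      {-1 - α ^ 2 - (k₁ : ℂ) * α ^ 3 - ((a : ℂ) - 1) * α ^ 4}) := by
  obtain ⟨r, t, P⟩ := exists_par a ha α hroot hα
  have fwd : ∀ z, z ∈ gEven a α k₁ '' Bprime a α ∩ gOdd α k₂ '' BSet a α (α - 1) →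
      k₂ - k₁ + 1 = 1 ∧ z = -1 - α ^ 2 - (k₂ : ℂ) * α ^ 3 - ((a : ℂ) - 1) * α ^ 4 := by
    rintro z ⟨⟨w, ⟨-, c, hc, hc3, hw⟩, rfl⟩, ⟨w', ⟨-, y, ⟨f, hf, hy⟩, hw'⟩, hz⟩⟩
    simp only [] at hw'
    rw [sum3] at hw
    rw [sum2] at hy
    have hu := P.unique (c := fun n => c (n + 3)) (f := fun n => f (n + 2))
      (fun n => hc.1 _ (by omega)) (fun n => hf.1 _ (by omega)) (by simpa using hc3)
      (m := k₂ - k₁ + 1) (by omega) (by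
        unfold gEven gOdd at hz
        rw [← hw', hy, hw] at hz
        apply mul_left_cancel₀ (pow_ne_zero 3 P.ne)
        push_cast
        linear_combination (-1 : ℂ) * hz + α * P.root)
    refine ⟨hu.1, ?_⟩
    rw [← hz, ← hw', hy, hu.2]
    unfold gOdd
    linear_combination (-α ^ 2) * P.root
  constructor
  · intro hlt
    rw [Set.eq_empty_iff_forall_notMem]
    intro z hz
    have := (fwd z hz).1
    omega
  · intro heq
    subst heq
    apply Set.Subset.antisymm
    · intro z hz
      exact (fwd z hz).2
    · rintro z rfl
      constructor
      · refine ⟨-1 - α ^ 3, ⟨⟨?_, -α - α ^ 3, ?_, by ring⟩, ?_⟩, ?_⟩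
        · refine P.mem_rauzy 1 (a - 1) (a - 2) 0 (by unfold Good; omega) ?_
          simp only [tailv]
          push_cast
          linear_combination (1 + α) * P.root
        · refine P.mem_rauzy 0 0 (a - 2) (a - 1) (by unfold Good; omega) ?_
          simp only [tailv]
          push_cast
          linear_combination (α + α ^ 2) * P.root
        · have h : Good a 1 (a - 2) (a - 1) 0 := by unfold Good; omega
          refine ⟨_, pre3_adm ha h 3, ?_, ?_⟩
          · simp only [sub_self, Int.toNat_zero, pre3]; omega
          · rw [sum3 (fun i => pre3 a 1 (a - 2) (a - 1) 0 (i - 3).toNat), pre3_shift, P.V_pre3 h]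
            simp only [tailv]
            push_cast
            linear_combination (α + α ^ 2) * P.root
        · unfold gEven
          linear_combination (-α - α ^ 2) * P.root
      · refine ⟨-α ^ 2 + α - 1, ⟨?_, -α ^ 2, ?_, by ring⟩, ?_⟩
        · refine P.mem_rauzy 2 (a - 1) 0 0 (by unfold Good; omega) ?_
          simp only [tailv]
          push_cast
          linear_combination P.root
        · refine P.mem_rauzy 3 0 0 (a - 1) (by unfold Good; omega) ?_
          simp only [tailv]
          push_cast
          ring
        · unfold gOdd
          linear_combination (-α ^ 2) * P.root
end
end

section
/- Let k₁, k₂ be integers with 0 ≤ k₁ < k₂ ≤ a-1 and k₁ ≤ a-2. If k₂ > k₁ + 1 then g_{2k₁+1}(B_{α-1}) ∩ g_{2k₂}(B'_{α-1}) = ∅, while if k₂ = k₁ + 1 then g_{2k₁+1}(B_{α-1}) ∩ g_{2(k₁+1)}(B'_{α-1}) = { -1 - (k₁+1)·α³ }. -/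
open Complex Filter Topology

noncomputable section

/-! ### Integer sequences: the forced period -/

/-- The linear recurrence with digit-size right hand side. -/
def RecBd (a : ℤ) (x : ℕ → ℤ) : Prop :=
  ∀ n, |x (n + 3) - x (n + 2) + a * x (n + 1) - x n| ≤ a - 1

lemma sup_attained (x : ℕ → ℤ) (K : ℤ) (hK : ∀ n, |x n| ≤ K) :
    ∃ m, ∀ n, |x n| ≤ |x m| := by
  have hfin : (Set.range (fun n => |x n|)).Finite := by
    apply (Set.finite_Icc 0 K).subset
    rintro _ ⟨n, rfl⟩
    exact ⟨abs_nonneg _, hK n⟩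
  obtain ⟨y, ⟨m, rfl⟩, hm⟩ := Set.exists_max_image _ id hfin ⟨_, ⟨0, rfl⟩⟩
  exact ⟨m, fun n => hm _ ⟨n, rfl⟩⟩

/-- A priori bound. -/
lemma apriori (a : ℤ) (ha : 3 ≤ a) (x : ℕ → ℤ) (K : ℤ) (hK : ∀ n, |x n| ≤ K)
    (hrec : RecBd a x) (h0 : |x 0| = 1) :
    ∃ M : ℤ, (∀ n, |x n| ≤ M) ∧ (M = 1 ∨ (a ^ 2 - 1) * M ≤ a ^ 2 - 1 + 2 * a * M) := by
  obtain ⟨m, hm⟩ := sup_attained x K hK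
  refine ⟨|x m|, hm, ?_⟩
  rcases m with _ | n
  · exact Or.inl h0
  right
  have e0 : |x (n + 3) - x (n + 2) + a * x (n + 1) - x n| ≤ a - 1 := hrec n
  have e1 : |x (n + 4) - x (n + 3) + a * x (n + 2) - x (n + 1)| ≤ a - 1 := hrec (n + 1)
  have b0 := hm n
  have b3 := hm (n + 3)
  have b4 := hm (n + 4)
  have hx : x (n + 1) = |x (n + 1)| ∨ x (n + 1) = -|x (n + 1)| := by
    rcases abs_choice (x (n + 1)) with h | h <;> omega
  generalize |x (n + 1)| = M at *
  rw [abs_le] at e0 e1 b0 b3 b4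
  have p0 := mul_le_mul_of_nonneg_left e0.1 (by omega : (0 : ℤ) ≤ a)
  have p0' := mul_le_mul_of_nonneg_left e0.2 (by omega : (0 : ℤ) ≤ a)
  have q0 := mul_le_mul_of_nonneg_left b0.1 (by omega : (0 : ℤ) ≤ a)
  have q0' := mul_le_mul_of_nonneg_left b0.2 (by omega : (0 : ℤ) ≤ a)
  have q3 := mul_le_mul_of_nonneg_left b3.1 (by omega : (0 : ℤ) ≤ a - 1)
  have q3' := mul_le_mul_of_nonneg_left b3.2 (by omega : (0 : ℤ) ≤ a - 1)
  rcases hx with h | h <;> rw [h] at e0 e1 p0 p0' <;> linarith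

lemma key (a : ℤ) (ha : 3 ≤ a) (x : ℕ → ℤ) (K : ℤ) (hK : ∀ n, |x n| ≤ K)
    (hrec : RecBd a x) (h0 : x 0 = 1) (h1 : x 1 = 1) (h2 : x 2 ≤ -1) :
    x 2 = -1 ∧ x 3 = -1 := by
  obtain ⟨M, hM, hM'⟩ := apriori a ha x K hK hrec (by rw [h0]; rfl)
  have small : ∀ b : ℤ, a = b → b = 3 ∨ b = 4 → (∀ n, |x n| ≤ 2) → x 2 = -1 ∧ x 3 = -1 := by
    rintro b rfl hb h
    have r0 := abs_le.1 (hrec 0)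
    have r1 := abs_le.1 (hrec 1)
    have r2 := abs_le.1 (hrec 2)
    have b2 := abs_le.1 (h 2)
    have b3 := abs_le.1 (h 3)
    have b4 := abs_le.1 (h 4)
    have b5 := abs_le.1 (h 5)
    simp only [Nat.reduceAdd, zero_add] at r0 r1 r2
    rcases hb with rfl | rfl <;> omega
  by_cases h5 : 5 ≤ a
  · have hM1 : M ≤ 1 := by
      rcases hM' with h | h
      · omega
      · by_contra hc
        have hc : 2 ≤ M := by omega
        have : 5 * a ≤ a * a := mul_le_mul_of_nonneg_right h5 (by omega)
        have h6 : 0 ≤ a ^ 2 - 1 - 2 * a := by nlinarith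
        have := mul_le_mul_of_nonneg_left hc h6
        nlinarith
    have r0 := abs_le.1 (hrec 0)
    have b2 := abs_le.1 (hM 2)
    have b3 := abs_le.1 (hM 3)
    simp only [Nat.reduceAdd, zero_add] at r0
    rw [h0, h1] at r0
    omega
  · obtain h | h : a = 3 ∨ a = 4 := by omega
    · refine small 3 h (Or.inl rfl) ?_
      subst h
      have hM4 : M ≤ 4 := by omega
      have step : ∀ B : ℤ, (B = 4 ∨ B = 3) → (∀ n, |x n| ≤ B) → ∀ n, |x n| ≤ B - 1 := by
        intro B hB hM n
        rcases n with _ | _ | n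
        · simp [h0]
          omega
        · simp [h1]
          omega
        have r0 : |x (n + 3) - x (n + 2) + 3 * x (n + 1) - x n| ≤ 3 - 1 := hrec n
        have r1 : |x (n + 4) - x (n + 3) + 3 * x (n + 2) - x (n + 1)| ≤ 3 - 1 := hrec (n + 1)
        have r2 : |x (n + 5) - x (n + 4) + 3 * x (n + 3) - x (n + 2)| ≤ 3 - 1 := hrec (n + 2)
        have r3 : |x (n + 6) - x (n + 5) + 3 * x (n + 4) - x (n + 3)| ≤ 3 - 1 := hrec (n + 3)
        have b0 := hM n
        have b1 := hM (n + 1)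
        have b2 := hM (n + 2)
        have b3 := hM (n + 3)
        have b4 := hM (n + 4)
        have b5 := hM (n + 5)
        have b6 := hM (n + 6)
        change |x (n + 2)| ≤ B - 1
        rw [abs_le] at *
        clear hK hrec h0 h1 h2 hM hM' small ha h5
        rcases hB with rfl | rfl
        · constructor <;> linarith
        · constructor <;> linarith
      exact step 3 (Or.inr rfl) (step 4 (Or.inl rfl) fun n => (hM n).trans hM4)
    · refine small 4 h (Or.inr rfl) ?_
      subst h
      have : M ≤ 2 := by omega
      exact fun n => (hM n).trans this

lemma key_neg (a : ℤ) (ha : 3 ≤ a) (x : ℕ → ℤ) (K : ℤ) (hK : ∀ n, |x n| ≤ K)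
    (hrec : RecBd a x) (h0 : x 0 = -1) (h1 : x 1 = -1) (h2 : 1 ≤ x 2) :
    x 2 = 1 ∧ x 3 = 1 := by
  have := key a ha (fun n => - x n) K (by simpa using hK) (fun n => by
    have := hrec n
    rw [← abs_neg] at this
    convert this using 2
    ring) (by simp [h0]) (by simp [h1]) (by simpa using h2)
  omega

lemma periodic (a : ℤ) (ha : 3 ≤ a) (x : ℕ → ℤ) (K : ℤ) (hK : ∀ n, |x n| ≤ K)
    (hrec : RecBd a x) (h0 : x 0 = 1) (h1 : x 1 = 1) (h2 : x 2 ≤ -1) (n : ℕ) :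
    x (4 * n) = 1 ∧ x (4 * n + 1) = 1 ∧ x (4 * n + 2) = -1 ∧ x (4 * n + 3) = -1 := by
  have half : ∀ n, x (4 * n) = 1 → x (4 * n + 1) = 1 → x (4 * n + 2) ≤ -1 →
      x (4 * n + 2) = -1 ∧ x (4 * n + 3) = -1 := fun n p0 p1 p2 =>
    key a ha (fun i => x (4 * n + i)) K (fun i => hK _) (fun i => hrec (4 * n + i)) p0 p1 p2
  induction n with
  | zero =>
    have := half 0 h0 h1 h2
    exact ⟨h0, h1, this.1, this.2⟩
  | succ n ih =>
    obtain ⟨p0, p1, p2, p3⟩ := ih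
    have e1 : |x (4 * n + 4) - x (4 * n + 3) + a * x (4 * n + 2) - x (4 * n + 1)| ≤ a - 1 :=
      hrec (4 * n + 1)
    rw [abs_le] at e1
    rw [p1, p2, p3] at e1
    have q := key_neg a ha (fun i => x (4 * n + 2 + i)) K (fun i => hK _)
      (fun i => hrec (4 * n + 2 + i)) p2 p3 (by
        change 1 ≤ x (4 * n + 4)
        linarith)
    have q4 : x (4 * n + 4) = 1 := q.1
    have q5 : x (4 * n + 5) = 1 := q.2
    have e3 : |x (4 * n + 6) - x (4 * n + 5) + a * x (4 * n + 4) - x (4 * n + 3)| ≤ a - 1 :=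
      hrec (4 * n + 3)
    rw [abs_le] at e3
    rw [p3, q4, q5] at e3
    have := half (n + 1) q4 q5 (by
      change x (4 * n + 6) ≤ -1
      linarith)
    exact ⟨q4, q5, this.1, this.2⟩

/-! ### The root -/

lemma normSq_lt_one (a : ℤ) (ha : 3 ≤ a) (α : ℂ)
    (hroot : α ^ 3 - (a : ℂ) * α ^ 2 + α - 1 = 0) (hα : α.im ≠ 0) :
    α.re ^ 2 + α.im ^ 2 < 1 := by
  have hre := congrArg Complex.re hroot
  have him := congrArg Complex.im hroot
  simp [pow_succ] at hre him
  set r := α.re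
  set s := α.im
  have ha' : (3 : ℝ) ≤ a := by exact_mod_cast ha
  have e1 : s ^ 2 = 3 * r ^ 2 - 2 * a * r + 1 := by
    apply mul_left_cancel₀ hα
    linear_combination -him
  have e2 : (a - 2 * r) * (r ^ 2 + s ^ 2) = 1 := by
    linear_combination hre + (r - (0:ℝ)) * e1
  have e3 : 2 * r * (a - 2 * r) + (r ^ 2 + s ^ 2) = 1 := by
    linear_combination e1
  by_contra hc
  push Not at hc
  have h1 : 0 < a - 2 * r := by
    by_contra h
    push Not at h
    nlinarith
  have h2 : r ≤ 0 := by
    by_contra h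
    push Not at h
    nlinarith [mul_pos h h1]
  nlinarith

lemma norm_lt_one' (a : ℤ) (ha : 3 ≤ a) (α : ℂ)
    (hroot : α ^ 3 - (a : ℂ) * α ^ 2 + α - 1 = 0) (hα : α.im ≠ 0) : ‖α‖ < 1 := by
  have h := normSq_lt_one a ha α hroot hα
  have : ‖α‖ ^ 2 < 1 := by
    rw [Complex.sq_norm, Complex.normSq_apply]
    nlinarith
  nlinarith [norm_nonneg α]

/-! ### From expansions to integer sequences -/

lemma summable_digits (B : ℝ) (α : ℂ) (h1 : ‖α‖ < 1) (d : ℕ → ℤ)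
    (hd : ∀ n, |(d n : ℝ)| ≤ B) (k : ℕ) : Summable (fun n => (d n : ℂ) * α ^ (n + k)) := by
  have hg : Summable (fun n : ℕ => B * ‖α‖ ^ k * ‖α‖ ^ n) :=
    (summable_geometric_of_lt_one (norm_nonneg _) h1).mul_left _
  refine Summable.of_norm_bounded hg (fun n => ?_)
  rw [norm_mul, norm_pow, Complex.norm_intCast, pow_add]
  have := mul_le_mul_of_nonneg_right (hd n)
    (by positivity : 0 ≤ ‖α‖ ^ n * ‖α‖ ^ k)
  nlinarith

lemma norm_tsum_digits (B : ℝ) (α : ℂ) (h1 : ‖α‖ < 1) (d : ℕ → ℤ)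
    (hd : ∀ n, |(d n : ℝ)| ≤ B) (k : ℕ) :
    ‖∑' n, (d n : ℂ) * α ^ (n + k)‖ ≤ B * ‖α‖ ^ k * (1 - ‖α‖)⁻¹ := by
  have hg := (hasSum_geometric_of_lt_one (norm_nonneg α) h1).mul_left (B * ‖α‖ ^ k)
  refine tsum_of_norm_bounded hg (fun n => ?_)
  rw [norm_mul, norm_pow, Complex.norm_intCast, pow_add]
  have := mul_le_mul_of_nonneg_right (hd n)
    (by positivity : 0 ≤ ‖α‖ ^ n * ‖α‖ ^ k)
  nlinarith

/-- The sequence of states. -/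
def xs (a j : ℤ) (d : ℕ → ℤ) : ℕ → ℤ
  | 0 => 1
  | 1 => 1
  | 2 => -j
  | n + 3 => xs a j d (n + 2) - a * xs a j d (n + 1) + xs a j d n - d n

lemma xs_state (a j : ℤ) (d : ℕ → ℤ) (α : ℂ) (B : ℝ) (h1 : ‖α‖ < 1) (hα0 : α ≠ 0)
    (hroot : α ^ 3 - (a : ℂ) * α ^ 2 + α - 1 = 0)
    (hd : ∀ n, |(d n : ℝ)| ≤ B)
    (hsum : ∑' n, (d n : ℂ) * α ^ (n + 2) = α ^ 2 - (j + 1) * α + 1) (n : ℕ) :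
    ∑' m, (d (n + m) : ℂ) * α ^ (m + 2) =
      xs a j d (n + 1) + (xs a j d (n + 2) - xs a j d (n + 1)) * α + xs a j d n * α ^ 2 := by
  induction n with
  | zero =>
    simp only [zero_add, hsum, xs]
    push_cast
    ring
  | succ n ih =>
    have hs := summable_digits B α h1 (fun m => d (n + m)) (fun m => hd _) 2
    rw [hs.tsum_eq_zero_add] at ih
    have : ∑' m : ℕ, (d (n + (m + 1)) : ℂ) * α ^ (m + 1 + 2)
        = α * ∑' m : ℕ, (d (n + 1 + m) : ℂ) * α ^ (m + 2) := by
      rw [← tsum_mul_left]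
      congr 1
      ext m
      rw [show n + (m + 1) = n + 1 + m by ring]
      ring
    rw [this] at ih
    apply mul_left_cancel₀ hα0
    have hx : xs a j d (n + 1 + 2) =
      xs a j d (n + 2) - a * xs a j d (n + 1) + xs a j d n - d n := rfl
    rw [hx]
    simp only [add_zero, zero_add] at ih
    rw [show n + 1 + 1 = n + 2 by ring]
    push_cast
    linear_combination ih - (xs a j d (n + 1) : ℂ) * hroot

lemma xs_bdd (a j : ℤ) (ha : 3 ≤ a) (d : ℕ → ℤ) (α : ℂ) (B : ℝ) (hα : α.im ≠ 0)
    (hroot : α ^ 3 - (a : ℂ) * α ^ 2 + α - 1 = 0)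
    (hd : ∀ n, |(d n : ℝ)| ≤ B)
    (hsum : ∑' n, (d n : ℂ) * α ^ (n + 2) = α ^ 2 - (j + 1) * α + 1) :
    ∃ K : ℤ, ∀ n, |xs a j d n| ≤ K := by
  have h1 := norm_lt_one' a ha α hroot hα
  have hN := normSq_lt_one a ha α hroot hα
  have hα0 : α ≠ 0 := by
    rintro rfl
    simp at hα
  set N := α.re ^ 2 + α.im ^ 2 with hNdef
  have hN0 : 0 ≤ N := by positivity
  set C := B * ‖α‖ ^ 2 * (1 - ‖α‖)⁻¹ with hC
  have hstep : ∀ n, |(xs a j d (n + 1) : ℝ) - N * xs a j d n| ≤ C * ‖α‖ / |α.im| := by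
    intro n
    have hb := norm_tsum_digits B α h1 (fun m => d (n + m)) (fun m => hd _) 2
    rw [xs_state a j d α B h1 hα0 hroot hd hsum n] at hb
    set v : ℂ := xs a j d (n + 1) + (xs a j d (n + 2) - xs a j d (n + 1)) * α
      + xs a j d n * α ^ 2 with hv
    have him : (v * (starRingEnd ℂ) α).im =
        -(α.im * ((xs a j d (n + 1) : ℝ) - N * xs a j d n)) := by
      simp [hv, hNdef, pow_two]
      ring
    have hle := Complex.abs_im_le_norm (v * (starRingEnd ℂ) α)
    rw [him, abs_neg, abs_mul, norm_mul, Complex.norm_conj] at hle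
    rw [le_div_iff₀ (abs_pos.2 hα)]
    have := mul_le_mul_of_nonneg_right hb (norm_nonneg α)
    linarith
  set E := C * ‖α‖ / |α.im| with hE
  have hE0 : 0 ≤ E := (abs_nonneg _).trans (hstep 0)
  have hpos : 0 < 1 - N := by linarith
  have hb : ∀ n, |(xs a j d n : ℝ)| ≤ 1 + E / (1 - N) := by
    have hq : E / (1 - N) * (1 - N) = E := div_mul_cancel₀ _ hpos.ne'
    have hq0 : 0 ≤ E / (1 - N) := by positivity
    intro n
    induction n with
    | zero =>
      simp [xs]
      exact hq0
    | succ n ih =>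
      have h2 := abs_le.1 (hstep n)
      have h3 := abs_le.1 ih
      have h4 := mul_le_mul_of_nonneg_left h3.1 hN0
      have h5 := mul_le_mul_of_nonneg_left h3.2 hN0
      rw [abs_le]
      constructor <;> nlinarith
  refine ⟨⌈1 + E / (1 - N)⌉, fun n => ?_⟩
  have : ((|xs a j d n| : ℤ) : ℝ) ≤ ⌈1 + E / (1 - N)⌉ := by
    push_cast
    exact (hb n).trans (Int.le_ceil _)
  exact_mod_cast this

/-- The digits are forced. -/
lemma forced (a j : ℤ) (ha : 3 ≤ a) (hj : 1 ≤ j) (d : ℕ → ℤ) (α : ℂ) (hα : α.im ≠ 0)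
    (hroot : α ^ 3 - (a : ℂ) * α ^ 2 + α - 1 = 0)
    (hd : ∀ n, |d n| ≤ a - 1)
    (hsum : ∑' n, (d n : ℂ) * α ^ (n + 2) = α ^ 2 - (j + 1) * α + 1) :
    j = 1 ∧ ∀ n, d (n + 1) = if n % 4 < 2 then a - 1 else -(a - 1) := by
  have hd' : ∀ n, |(d n : ℝ)| ≤ ((a - 1 : ℤ) : ℝ) := fun n => by exact_mod_cast hd n
  obtain ⟨K, hK⟩ := xs_bdd a j ha d α _ hα hroot hd' hsum
  have hdx : ∀ n, xs a j d (n + 3) =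
      xs a j d (n + 2) - a * xs a j d (n + 1) + xs a j d n - d n := fun n => rfl
  have hrec : RecBd a (xs a j d) := fun n => by
    rw [hdx, ← abs_neg]
    convert hd n using 2
    ring
  have h2 : xs a j d 2 = -j := rfl
  have per := periodic a ha (xs a j d) K hK hrec rfl rfl (by omega)
  refine ⟨by have := (per 0).2.2.1; simp [h2] at this; omega, fun n => ?_⟩
  obtain ⟨p0, p1, p2, p3⟩ := per (n / 4)
  obtain ⟨q0, q1, q2, q3⟩ := per (n / 4 + 1)
  have e := hdx (n + 1)
  obtain h | h | h | h : n % 4 = 0 ∨ n % 4 = 1 ∨ n % 4 = 2 ∨ n % 4 = 3 := by omega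
  · rw [show n + 1 + 3 = 4 * (n / 4 + 1) by omega, show n + 1 + 2 = 4 * (n / 4) + 3 by omega,
      show n + 1 + 1 = 4 * (n / 4) + 2 by omega, show n + 1 = 4 * (n / 4) + 1 by omega,
      p1, p2, p3, q0, show 4 * (n / 4) + 1 = n + 1 by omega] at e
    rw [if_pos (by omega)]
    linarith
  · rw [show n + 1 + 3 = 4 * (n / 4 + 1) + 1 by omega, show n + 1 + 2 = 4 * (n / 4 + 1) by omega,
      show n + 1 + 1 = 4 * (n / 4) + 3 by omega, show n + 1 = 4 * (n / 4) + 2 by omega,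
      p2, p3, q0, q1, show 4 * (n / 4) + 2 = n + 1 by omega] at e
    rw [if_pos (by omega)]
    linarith
  · rw [show n + 1 + 3 = 4 * (n / 4 + 1) + 2 by omega,
      show n + 1 + 2 = 4 * (n / 4 + 1) + 1 by omega,
      show n + 1 + 1 = 4 * (n / 4 + 1) by omega, show n + 1 = 4 * (n / 4) + 3 by omega,
      p3, q0, q1, q2, show 4 * (n / 4) + 3 = n + 1 by omega] at e
    rw [if_neg (by omega)]
    linarith
  · rw [show n + 1 + 3 = 4 * (n / 4 + 1) + 3 by omega,
      show n + 1 + 2 = 4 * (n / 4 + 1) + 2 by omega,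
      show n + 1 + 1 = 4 * (n / 4 + 1) + 1 by omega, show n + 1 = 4 * (n / 4 + 1) by omega,
      q0, q1, q2, q3, show 4 * (n / 4 + 1) = n + 1 by omega] at e
    rw [if_neg (by omega)]
    linarith

/-! ### The periodic expansion of `-1` -/

/-- Periodic digits. -/
def per (a : ℤ) (n : ℕ) : ℤ := if n % 4 < 2 then a - 1 else 0

lemma per_abs (a : ℤ) (ha : 3 ≤ a) (n : ℕ) : |(per a n : ℝ)| ≤ ((a - 1 : ℤ) : ℝ) := by
  have : |per a n| ≤ a - 1 := by
    rw [abs_le]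
    unfold per
    split_ifs <;> constructor <;> omega
  exact_mod_cast this

lemma per_hasSum (a : ℤ) (ha : 3 ≤ a) (α : ℂ)
    (hroot : α ^ 3 - (a : ℂ) * α ^ 2 + α - 1 = 0) (hα : α.im ≠ 0) :
    HasSum (fun n => (per a n : ℂ) * α ^ (n + 2)) (-1) := by
  have h1 := norm_lt_one' a ha α hroot hα
  have hs := summable_digits _ α h1 (per a) (per_abs a ha) 2
  have key := hs.sum_add_tsum_nat_add 4
  have e : ∑' n : ℕ, (per a (n + 4) : ℂ) * α ^ (n + 4 + 2)
      = α ^ 4 * ∑' n : ℕ, (per a n : ℂ) * α ^ (n + 2) := by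
    rw [← tsum_mul_left]
    congr 1
    ext n
    have : per a (n + 4) = per a n := by simp [per]
    rw [this]
    ring
  rw [e] at key
  have hf : ∑ i ∈ Finset.range 4, (per a i : ℂ) * α ^ (i + 2) =
      (a - 1) * α ^ 2 + (a - 1) * α ^ 3 := by
    simp [Finset.sum_range_succ, per]
  rw [hf] at key
  have h4 : (1 : ℂ) - α ^ 4 ≠ 0 := by
    intro h
    have : ‖α ^ 4‖ = 1 := by
      rw [show α ^ 4 = 1 by linear_combination -h]
      simp
    rw [norm_pow] at this
    have := pow_lt_one₀ (norm_nonneg α) h1 (n := 4) (by norm_num)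
    linarith
  have hval : ∑' n : ℕ, (per a n : ℂ) * α ^ (n + 2) = -1 := by
    apply mul_left_cancel₀ h4
    linear_combination -key - (α + 1) * hroot
  rw [← hval]
  exact hs.hasSum

/-- Shifted periodic digits. -/
def shp (a m i : ℤ) : ℤ := if m ≤ i ∧ (i - m) % 4 < 2 then a - 1 else 0

lemma shp_hasSum (a : ℤ) (ha : 3 ≤ a) (α : ℂ)
    (hroot : α ^ 3 - (a : ℂ) * α ^ 2 + α - 1 = 0) (hα : α.im ≠ 0) (p k : ℕ) :
    HasSum (fun n : ℕ => (shp a (k + p) (n + k) : ℂ) * α ^ (n + k + 2)) (-α ^ (k + p)) := by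
  have h := (per_hasSum a ha α hroot hα).mul_left (α ^ (k + p))
  rw [← hasSum_nat_add_iff' p]
  have hz : ∑ i ∈ Finset.range p, (shp a (k + p) (i + k) : ℂ) * α ^ (i + k + 2) = 0 := by
    apply Finset.sum_eq_zero
    intro i hi
    have := Finset.mem_range.1 hi
    have : shp a (k + p) (i + k) = 0 := by
      unfold shp
      rw [if_neg (by omega)]
    rw [this]
    simp
  rw [hz, sub_zero]
  rw [mul_neg_one] at h
  convert! h using 1
  ext n
  · have : shp a (k + p) (((n + p : ℕ) : ℤ) + k) = per a n := by
      unfold shp per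
      congr 1
      apply propext
      push_cast
      omega
    rw [this]
    ring

lemma shp_admissible (a : ℤ) (ha : 3 ≤ a) (k m : ℤ) : Admissible a k (shp a m) := by
  refine ⟨fun i hi => ?_, fun i hi => ?_⟩
  · unfold shp
    split_ifs <;> omega
  · unfold WordLt shp
    split_ifs <;> omega

theorem g_odd_even_inter (a : ℤ) (ha : 3 ≤ a) (α : ℂ)
    (hroot : α ^ 3 - (a : ℂ) * α ^ 2 + α - 1 = 0) (hα : α.im ≠ 0)
    (k₁ k₂ : ℤ) (hk₁ : 0 ≤ k₁) (hk₁₂ : k₁ < k₂) (hk₂ : k₂ ≤ a - 1) (hk₁' : k₁ ≤ a - 2) :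
    (k₁ + 1 < k₂ → gOdd α k₁ '' BSet a α (α - 1) ∩ gEven a α k₂ '' Bprime a α = ∅) ∧
    (k₂ = k₁ + 1 → gOdd α k₁ '' BSet a α (α - 1) ∩ gEven a α (k₁ + 1) '' Bprime a α =
      {-1 - ((k₁ : ℂ) + 1) * α ^ 3}) := by
  have hα0 : α ≠ 0 := by
    rintro rfl
    simp at hα
  have h1 := norm_lt_one' a ha α hroot hα
  have main : ∀ z₁ ∈ Rauzy a α, ∀ z₂ ∈ Rauzy a α, gOdd α k₁ z₁ = gEven a α k₂ z₂ →
      k₂ = k₁ + 1 ∧ z₁ = -1 := by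
    rintro z₁ ⟨c, ⟨hc, -⟩, hz₁⟩ z₂ ⟨f, ⟨hf, -⟩, hz₂⟩ heq
    set d : ℕ → ℤ := fun n => (if n = 0 then 0 else c ((n : ℤ) + 1)) - f ((n : ℤ) + 2) with hd
    have hdb : ∀ n, |d n| ≤ a - 1 := by
      intro n
      have h2 := hf ((n : ℤ) + 2) (by omega)
      rw [abs_le]
      simp only [hd]
      split_ifs with h
      · omega
      · have h3 := hc ((n : ℤ) + 1) (by omega)
        omega
    have hcs : Summable (fun n : ℕ => (c ((n : ℤ) + 2) : ℂ) * α ^ (n + 2)) :=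
      summable_digits ((a - 1 : ℤ) : ℝ) α h1 (fun n : ℕ => c ((n : ℤ) + 2)) (fun n => by
        have := hc ((n : ℤ) + 2) (by omega)
        have : |c ((n : ℤ) + 2)| ≤ a - 1 := by rw [abs_le]; omega
        exact_mod_cast this) 2
    have hfs : Summable (fun n : ℕ => (f ((n : ℤ) + 2) : ℂ) * α ^ (n + 2)) :=
      summable_digits ((a - 1 : ℤ) : ℝ) α h1 (fun n : ℕ => f ((n : ℤ) + 2)) (fun n => by
        have := hf ((n : ℤ) + 2) (by omega)
        have : |f ((n : ℤ) + 2)| ≤ a - 1 := by rw [abs_le]; omega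
        exact_mod_cast this) 2
    have hcH : HasSum (fun n : ℕ => ((if n = 0 then 0 else c ((n : ℤ) + 1) : ℤ) : ℂ)
        * α ^ (n + 2)) (α * z₁) := by
      rw [← hasSum_nat_add_iff' 1]
      have := hcs.hasSum.mul_left α
      rw [← hz₁] at this
      convert! this using 1
      · ext n
        rw [if_neg (by omega)]
        push_cast
        rw [show (n : ℤ) + 1 + 1 = n + 2 by ring]
        ring
      · simp
    have hdH := hcH.sub (hz₂ ▸ hfs.hasSum)
    have hds : ∑' n, (d n : ℂ) * α ^ (n + 2) = α * z₁ - z₂ := by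
      rw [← hdH.tsum_eq]
      congr 1
      ext n
      simp only [hd]
      push_cast
      ring
    have hv : α * z₁ - z₂ = α ^ 2 - (((k₂ - k₁ : ℤ) : ℂ) + 1) * α + 1 := by
      apply mul_left_cancel₀ (pow_ne_zero 2 hα0)
      unfold gOdd gEven at heq
      push_cast
      linear_combination heq - α * hroot
    obtain ⟨hj, hdig⟩ := forced a (k₂ - k₁) ha (by omega) d α hα hroot hdb (hds.trans hv)
    refine ⟨by omega, ?_⟩
    rw [hz₁, ← (per_hasSum a ha α hroot hα).tsum_eq]
    congr 1
    ext n
    have h2 := hdig n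
    have h3 := hc ((n : ℤ) + 2) (by omega)
    have h4 := hf ((n : ℤ) + 3) (by omega)
    simp only [hd] at h2
    push_cast at h2
    rw [show (n : ℤ) + 1 + 1 = n + 2 by ring,
      show (n : ℤ) + 1 + 2 = n + 3 by ring] at h2
    have : c ((n : ℤ) + 2) = per a n := by
      unfold per
      split_ifs at h2 ⊢ <;> omega
    rw [this]
  have mem : ∀ p : ℕ, -α ^ p ∈ Rauzy a α := by
    intro p
    refine ⟨shp a (2 + p), shp_admissible a ha _ _, ?_⟩
    have := shp_hasSum a ha α hroot hα p 2
    apply mul_left_cancel₀ (pow_ne_zero 2 hα0)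
    rw [← tsum_mul_left]
    have e := this.tsum_eq
    push_cast at e
    rw [show α ^ 2 * -α ^ p = -α ^ (2 + p) by ring, ← e]
    congr 1
    ext n
    ring
  have memB : (-1 : ℂ) ∈ BSet a α (α - 1) := by
    refine ⟨by simpa using mem 0, -α, by simpa using mem 1, by ring⟩
  have memz : (a - 1 : ℂ) * α ^ 2 - α ^ 3 ∈ Rauzy a α := by
    refine ⟨fun i => if i = 2 then a - 1 else shp a 5 i, ⟨fun i hi => ?_, fun i hi => ?_⟩, ?_⟩
    · unfold shp
      simp only
      split_ifs <;> omega
    · unfold WordLt shp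
      simp only
      split_ifs <;> omega
    · have h := shp_hasSum a ha α hroot hα 2 3
      have h' : HasSum (fun n : ℕ => ((if (n : ℤ) + 2 = 2 then a - 1 else shp a 5 ((n : ℤ) + 2)
          : ℤ) : ℂ) * α ^ (n + 2)) ((a - 1 : ℂ) * α ^ 2 - α ^ 3) := by
        rw [← hasSum_nat_add_iff' 1]
        have h2 := h.mul_left (α ^ 2)⁻¹
        convert! h2 using 1
        · ext n
          rw [if_neg (by push_cast; omega)]
          push_cast
          rw [show (n : ℤ) + 1 + 2 = n + 3 by ring]
          field_simp
          norm_num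
          ring
        · simp
          field_simp
      exact h'.tsum_eq.symm
  have memB' : (a - 1 : ℂ) * α ^ 2 - α ^ 3 ∈ Bprime a α := by
    refine ⟨⟨memz, -α ^ 2, mem 2, ?_⟩, shp a 4, shp_admissible a ha _ _, ?_, ?_⟩
    · simp only
      linear_combination hroot
    · simp [shp]
      omega
    · have h := (shp_hasSum a ha α hroot hα 1 3).mul_left (α ^ 2)⁻¹
      have e : ∑' n : ℕ, (shp a 4 ((n : ℤ) + 3) : ℂ) * α ^ (n + 3) = -α ^ 2 := by
        have e2 := h.tsum_eq
        rw [show (α ^ 2)⁻¹ * -α ^ (3 + 1) = -α ^ 2 by field_simp] at e2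
        rw [← e2]
        congr 1
        ext n
        norm_num
        field_simp
        ring
      rw [e]
      linear_combination -hroot
  constructor
  · intro hlt
    rw [Set.eq_empty_iff_forall_notMem]
    rintro w ⟨⟨z₁, hz₁, rfl⟩, ⟨z₂, hz₂, h⟩⟩
    have := (main z₁ hz₁.1 z₂ hz₂.1.1 h.symm).1
    omega
  · rintro rfl
    ext w
    simp only [Set.mem_singleton_iff]
    constructor
    · rintro ⟨⟨z₁, hz₁, rfl⟩, ⟨z₂, hz₂, h⟩⟩
      have := (main z₁ hz₁.1 z₂ hz₂.1.1 h.symm).2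
      rw [this]
      unfold gOdd
      ring
    · rintro rfl
      refine ⟨⟨-1, memB, ?_⟩, ⟨_, memB', ?_⟩⟩
      · unfold gOdd
        ring
      · unfold gEven
        push_cast
        linear_combination (-α ^ 2 - α) * hroot
end
end

section
/- For integers k₁ ≠ k₂ with 0 ≤ k₁, k₂ ≤ a-1 one has g_{2k₁}(B'_{α-1}) ∩ g_{2k₂}(B'_{α-1}) = ∅, and for integers k₁ ≠ k₂ with 0 ≤ k₁, k₂ ≤ a-2 one has g_{2k₁+1}(B_{α-1}) ∩ g_{2k₂+1}(B_{α-1}) = ∅. -/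
open Complex Filter Topology

noncomputable section

lemma root_rel (a : ℤ) (ha : 3 ≤ a) (α : ℂ)
    (hroot : α ^ 3 - (a : ℂ) * α ^ 2 + α - 1 = 0) (hα : α.im ≠ 0) :
    ∃ r : ℝ, ‖α‖ = r ∧ 0 < r ∧ r < 0.602 ∧ α.re ^ 2 + α.im ^ 2 = r ^ 2 ∧
      2 * α.re = r ^ 2 * (1 - r ^ 2) ∧ (a : ℝ) * r ^ 2 = 1 + r ^ 4 - r ^ 6 := by
  have hr0 : 0 < ‖α‖ := by
    rw [norm_pos_iff]; rintro rfl; simp at hα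
  have hN : α.re ^ 2 + α.im ^ 2 = ‖α‖ ^ 2 := by
    rw [Complex.sq_norm, Complex.normSq_apply]; ring
  obtain ⟨x, y⟩ := α
  have h1 := congrArg Complex.re hroot
  have h2 := congrArg Complex.im hroot
  simp [pow_succ] at h1 h2
  simp only at hN hα ⊢
  generalize ‖(⟨x, y⟩ : ℂ)‖ = r at *
  have ha' : (3 : ℝ) ≤ a := by exact_mod_cast ha
  generalize (a : ℝ) = A at *
  have h3 : 3 * x ^ 2 - y ^ 2 - 2 * A * x + 1 = 0 := by
    apply mul_left_cancel₀ hα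
    linear_combination h2
  set N := r ^ 2 with hNdef
  have e1 : N + 2 * x * (A - 2 * x) = 1 := by
    rw [← hN]; linear_combination -h3
  have e2 : N * (A - 2 * x) = 1 := by
    rw [← hN]; linear_combination h1 - x * h3
  have hN0 : 0 < N := by positivity
  have e3 : 2 * x = N * (1 - N) := by
    linear_combination (-2 * x) * e2 + N * e1
  have e4 : A * N = 1 + N ^ 2 - N ^ 3 := by
    linear_combination e2 + N * e3
  refine ⟨r, rfl, hr0, ?_, hN, e3, by rw [e4, hNdef]; ring⟩
  by_contra hc
  push Not at hc
  have hN1 : 0.362404 ≤ N := by rw [hNdef]; nlinarith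
  have : 3 * N ≤ 1 + N ^ 2 - N ^ 3 := by rw [← e4]; nlinarith
  nlinarith [mul_nonneg hN0.le (sq_nonneg (N - 1/2)), mul_nonneg hN0.le (sq_nonneg N)]

lemma summ (a : ℤ) (α : ℂ) (hr : ‖α‖ < 1) (D : ℕ → ℤ) (hD : ∀ n, |D n| ≤ a - 1) :
    Summable (fun n => (D n : ℂ) * α ^ n) ∧
    ‖∑' n, (D n : ℂ) * α ^ n‖ ≤ ((a : ℝ) - 1) * (1 - ‖α‖)⁻¹ := by
  have hg := (hasSum_geometric_of_lt_one (norm_nonneg α) hr).mul_left ((a : ℝ) - 1)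
  have hb : ∀ n, ‖(D n : ℂ) * α ^ n‖ ≤ ((a : ℝ) - 1) * ‖α‖ ^ n := by
    intro n
    rw [norm_mul, norm_pow]
    gcongr
    rw [Complex.norm_intCast]
    exact_mod_cast hD n
  exact ⟨Summable.of_norm_bounded hg.summable hb, tsum_of_norm_bounded hg hb⟩

lemma summ2 (a : ℤ) (α : ℂ) (hr : ‖α‖ < 1) (c d : ℕ → ℤ)
    (hc : ∀ n, 0 ≤ c n ∧ c n ≤ a - 1) (hd : ∀ n, 0 ≤ d n ∧ d n ≤ a - 1) :
    ‖(∑' n, (c n : ℂ) * α ^ n) - ∑' n, (d n : ℂ) * α ^ n‖ ≤ ((a : ℝ) - 1) * (1 - ‖α‖)⁻¹ := by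
  have h1 := (summ a α hr c (fun n => by rw [abs_le]; have := hc n; omega)).1
  have h2 := (summ a α hr d (fun n => by rw [abs_le]; have := hd n; omega)).1
  rw [← h1.tsum_sub h2]
  have h3 := (summ a α hr (fun n => c n - d n)
    (fun n => by rw [abs_le]; have := hc n; have := hd n; omega)).2
  refine le_trans (le_of_eq ?_) h3
  congr 2; ext n; push_cast; ring

/-- Pull out a power of `α`. -/
lemma pull (α : ℂ) (c : ℤ → ℤ) (k : ℕ) :
    ∑' n : ℕ, (c ((n : ℤ) + k) : ℂ) * α ^ (n + k)
      = α ^ k * ∑' n : ℕ, (c ((n : ℤ) + k) : ℂ) * α ^ n := by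
  rw [← tsum_mul_left]; congr 1; ext n; ring

/-- Split off the first digit. -/
lemma split (a : ℤ) (α : ℂ) (hr : ‖α‖ < 1) (c : ℤ → ℤ) (k : ℤ)
    (hc : ∀ i, k ≤ i → 0 ≤ c i ∧ c i ≤ a - 1) :
    ∑' n : ℕ, (c ((n : ℤ) + k) : ℂ) * α ^ n
      = c k + α * ∑' n : ℕ, (c ((n : ℤ) + (k + 1)) : ℂ) * α ^ n := by
  have h1 := (summ a α hr (fun n => c ((n : ℤ) + k))
    (fun n => by rw [abs_le]; have := hc (n + k) (by omega); omega)).1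
  rw [h1.tsum_eq_zero_add, ← tsum_mul_left]
  congr 1
  · simp
  · congr 1; ext n
    have : ((n + 1 : ℕ) : ℤ) + k = (n : ℤ) + (k + 1) := by push_cast; ring
    rw [this]; ring

lemma odd_aux (a : ℤ) (ha : 3 ≤ a) (α : ℂ)
    (hroot : α ^ 3 - (a : ℂ) * α ^ 2 + α - 1 = 0) (hα : α.im ≠ 0)
    (z₁ z₂ : ℂ) (m : ℤ) (hm : 1 ≤ m) (h₁ : z₁ ∈ BSet a α (α - 1)) (h₂ : z₂ ∈ BSet a α (α - 1))
    (h : z₁ - z₂ = m) : False := by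
  obtain ⟨r, hr, hr0, hr1, hN, hx, hA⟩ := root_rel a ha α hroot hα
  have hlt : ‖α‖ < 1 := by rw [hr]; linarith
  obtain ⟨-, w, ⟨c, hc, rfl⟩, rfl⟩ := h₁
  obtain ⟨⟨d, hd, rfl⟩, -⟩ := h₂
  have p1 := pull α c 2
  have p2 := pull α d 2
  push_cast at p1 p2
  simp only at h
  rw [p1, p2] at h
  have hb := summ2 a α hlt (fun n => c ((n : ℤ) + 2)) (fun n => d ((n : ℤ) + 2))
    (fun n => hc.1 _ (by omega)) (fun n => hd.1 _ (by omega))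
  beta_reduce at hb
  generalize (∑' n : ℕ, (c ((n : ℤ) + 2) : ℂ) * α ^ n) = S at *
  generalize (∑' n : ℕ, (d ((n : ℤ) + 2) : ℂ) * α ^ n) = T at *
  have e : α ^ 2 * (S - T) = m + 1 - α := by linear_combination h
  have e2 := congrArg norm e
  rw [norm_mul, norm_pow, hr] at e2
  rw [hr] at hb
  have e3 : (m : ℝ) + 1 - α.re ≤ ‖(m : ℂ) + 1 - α‖ := by
    have := Complex.re_le_norm ((m : ℂ) + 1 - α)
    simpa using this
  have hm' : (1 : ℝ) ≤ m := by exact_mod_cast hm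
  have h1r : 0 < 1 - r := by linarith
  have e4 : r ^ 2 * ‖S - T‖ ≤ r ^ 2 * (((a : ℝ) - 1) * (1 - r)⁻¹) := by gcongr
  have e5 : 2 - α.re ≤ r ^ 2 * ((a : ℝ) - 1) / (1 - r) := by
    rw [div_eq_mul_inv]; linarith
  rw [le_div_iff₀ h1r] at e5
  have e6 : (2 - r ^ 2 * (1 - r ^ 2) / 2) * (1 - r) ≤ 1 + r ^ 4 - r ^ 6 - r ^ 2 := by
    have : α.re = r ^ 2 * (1 - r ^ 2) / 2 := by linarith
    rw [this] at e5; linarith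
  have hr2 : 0 ≤ 0.602 - r := by linarith
  nlinarith [mul_nonneg hr2 hr0.le, mul_nonneg (mul_nonneg hr2 hr0.le) hr0.le, pow_pos hr0 2,
    pow_pos hr0 3, pow_pos hr0 4, pow_pos hr0 5, pow_pos hr0 6, mul_nonneg hr2 (pow_pos hr0 5).le,
    mul_nonneg hr2 (pow_pos hr0 4).le, mul_nonneg hr2 (pow_pos hr0 3).le]

lemma im_bound (r x y : ℝ) (hr : 0 < r) (hr1 : r ^ 2 < 0.363) (hN : x ^ 2 + y ^ 2 = r ^ 2)
    (hx : 2 * x = r ^ 2 * (1 - r ^ 2)) : r ≤ 1.02 * |y| := by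
  apply le_of_sq_le_sq _ (by positivity)
  rw [mul_pow, sq_abs]
  have hx' : x = r ^ 2 * (1 - r ^ 2) / 2 := by linarith
  have hN0 : 0 < r ^ 2 := by positivity
  have hy : y ^ 2 = r ^ 2 - (r ^ 2 * (1 - r ^ 2) / 2) ^ 2 := by rw [← hx']; linarith
  rw [hy]
  generalize r ^ 2 = N at *
  have h : N * (1 - N) ^ 2 ≤ 4 / 27 := by
    nlinarith [mul_nonneg (sq_nonneg (3 * N - 1)) (by linarith : (0:ℝ) ≤ 4 - 3 * N)]
  nlinarith [mul_le_mul_of_nonneg_left h hN0.le]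

lemma fin_num (r y : ℝ) (hr0 : 0 < r) (hr1 : r < 0.602) (hy : 0 < y)
    (h : y * (3 - r ^ 2 + (r ^ 2) ^ 2 - (1 - r ^ 2 + (r ^ 2) ^ 2 - (r ^ 2) ^ 3) * (1 - r ^ 2)) ≤
      1.02 * y * ((1 - r ^ 2 + (r ^ 2) ^ 2 - (r ^ 2) ^ 3) * (1 - r)⁻¹)) : False := by
  have h1r : 0 < 1 - r := by linarith
  have hN0 : 0 < r ^ 2 := by positivity
  have hN1 : r ^ 2 < 0.363 := by nlinarith
  have q9 : 3 - r ^ 2 + (r ^ 2) ^ 2 - (1 - r ^ 2 + (r ^ 2) ^ 2 - (r ^ 2) ^ 3) * (1 - r ^ 2)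
      ≤ 1.02 * (1 - r ^ 2 + (r ^ 2) ^ 2 - (r ^ 2) ^ 3) / (1 - r) := by
    refine le_of_mul_le_mul_left (h.trans (le_of_eq ?_)) hy
    rw [div_eq_mul_inv]; ring
  rw [le_div_iff₀ h1r] at q9
  have q10 : 2 ≤ 3 - r ^ 2 + (r ^ 2) ^ 2
      - (1 - r ^ 2 + (r ^ 2) ^ 2 - (r ^ 2) ^ 3) * (1 - r ^ 2) := by
    generalize r ^ 2 = N at *
    nlinarith [pow_pos hN0 2, pow_pos hN0 3, pow_pos hN0 4, mul_pos hN0 (pow_pos hN0 2)]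
  have q11 := (mul_le_mul_of_nonneg_right q10 h1r.le).trans q9
  have hr2 : 0 ≤ 0.602 - r := by linarith
  have q12 : (r ^ 2) ^ 2 ≤ 0.363 * r ^ 2 := by nlinarith
  nlinarith [mul_nonneg hr2 hr0.le, pow_pos hN0 3]

lemma even_aux (a : ℤ) (ha : 3 ≤ a) (α : ℂ)
    (hroot : α ^ 3 - (a : ℂ) * α ^ 2 + α - 1 = 0) (hα : α.im ≠ 0)
    (z₁ z₂ : ℂ) (m : ℤ) (hm : 1 ≤ m) (h₁ : z₁ ∈ Bprime a α) (h₂ : z₂ ∈ Bprime a α)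
    (h : z₁ - z₂ = m * α) : False := by
  obtain ⟨r, hr, hr0, hr1, hN, hx, hA⟩ := root_rel a ha α hroot hα
  have hlt : ‖α‖ < 1 := by rw [hr]; linarith
  obtain ⟨⟨⟨c, hc, rfl⟩, -⟩, -⟩ := h₁
  obtain ⟨-, d, hd, hd3, rfl⟩ := h₂
  have p1 := pull α c 2
  have p2 := pull α d 3
  push_cast at p1 p2
  rw [p1, p2, split a α hlt c 2 hc.1, split a α hlt c (2 + 1) (fun i hi => hc.1 i (by omega)),
    split a α hlt c (2 + 1 + 1) (fun i hi => hc.1 i (by omega)),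
    split a α hlt d 3 hd.1, split a α hlt d (3 + 1) (fun i hi => hd.1 i (by omega))] at h
  norm_num at h
  have hb := summ2 a α hlt (fun n => c ((n : ℤ) + 5)) (fun n => d ((n : ℤ) + 5))
    (fun n => hc.1 _ (by omega)) (fun n => hd.1 _ (by omega))
  beta_reduce at hb
  generalize (∑' n : ℕ, (c ((n : ℤ) + 5) : ℂ) * α ^ n) = S at *
  generalize (∑' n : ℕ, (d ((n : ℤ) + 5) : ℂ) * α ^ n) = T at *
  have b3 : -((a : ℝ) - 2) ≤ (c 3 : ℝ) - d 3 := by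
    have := hc.1 3 (by omega); have := hd.1 3 (by omega)
    have : -(a - 2) ≤ c 3 - d 3 := by omega
    exact_mod_cast this
  have b4 : -((a : ℝ) - 1) ≤ (c 4 : ℝ) - d 4 := by
    have := hc.1 4 (by omega); have := hd.1 4 (by omega)
    have : -(a - 1) ≤ c 4 - d 4 := by omega
    exact_mod_cast this
  have hm' : (1 : ℝ) ≤ m := by exact_mod_cast hm
  have ha' : (3 : ℝ) ≤ a := by exact_mod_cast ha
  have h1r : 0 < 1 - r := by linarith
  have hα0 : α ≠ 0 := by rintro rfl; simp at hα
  -- divide by `α^2`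
  set t := α ^ 3 * (S - T) with ht
  have e : (c 2 : ℂ) + ((c 3 : ℂ) - d 3) * α + ((c 4 : ℂ) - d 4) * α ^ 2 + t
      = m * (α ^ 2 - a * α + 1) + a - α := by
    apply mul_left_cancel₀ (pow_ne_zero 2 hα0)
    linear_combination h - (m * α - 1) * hroot
  have ei := congrArg Complex.im e
  simp [pow_two] at ei
  have tb : |t.im| ≤ r ^ 3 * (((a : ℝ) - 1) * (1 - r)⁻¹) := by
    refine (Complex.abs_im_le_norm t).trans ?_
    rw [ht, norm_mul, norm_pow, hr]
    rw [hr] at hb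
    gcongr
  have ei2 : t.im = -α.im * ((c 3 : ℝ) - d 3 + (c 4 - d 4) * (2 * α.re) + m * (a - 2 * α.re) + 1) := by
    linear_combination ei
  set N := r ^ 2 with hNdef
  have hN0 : 0 < N := by positivity
  have hN1 : N < 0.363 := by rw [hNdef]; nlinarith
  have hA' : (a : ℝ) * N = 1 + N ^ 2 - N ^ 3 := by rw [hA, hNdef]; ring
  have hx0 : 0 ≤ 2 * α.re := by rw [hx]; apply mul_nonneg <;> linarith
  have q1 : -((a : ℝ) - 1) * (2 * α.re) ≤ (c 4 - d 4) * (2 * α.re) := by gcongr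
  have q2 : 1 * ((a : ℝ) - 2 * α.re) ≤ m * (a - 2 * α.re) := by
    gcongr
    rw [hx]; nlinarith
  have q3 : ((a : ℝ) - 1) * (2 * α.re) = (1 - N + N ^ 2 - N ^ 3) * (1 - N) := by
    rw [hx]; linear_combination (1 - N) * hA'
  have q4 : 3 - N + N ^ 2 - (1 - N + N ^ 2 - N ^ 3) * (1 - N) ≤
      (c 3 : ℝ) - d 3 + (c 4 - d 4) * (2 * α.re) + m * (a - 2 * α.re) + 1 := by
    nlinarith
  have hK : 0 ≤ 3 - N + N ^ 2 - (1 - N + N ^ 2 - N ^ 3) * (1 - N) := by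
    nlinarith [pow_pos hN0 2, pow_pos hN0 3, pow_pos hN0 4]
  have q5 : |α.im| * (3 - N + N ^ 2 - (1 - N + N ^ 2 - N ^ 3) * (1 - N)) ≤ |t.im| := by
    rw [ei2, abs_mul, abs_neg]
    gcongr
    exact q4.trans (le_abs_self _)
  have q6 : r ≤ 1.02 * |α.im| := by
    exact im_bound r α.re α.im hr0 hN1 hN hx
  have q7 : r ^ 3 * (((a : ℝ) - 1) * (1 - r)⁻¹) = r * ((1 - N + N ^ 2 - N ^ 3) * (1 - r)⁻¹) := by
    have : r ^ 3 = r * N := by rw [hNdef]; ring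
    rw [this]; linear_combination (r * (1 - r)⁻¹) * hA'
  have hAp : 0 < 1 - N + N ^ 2 - N ^ 3 := by nlinarith [pow_pos hN0 2]
  have q8 : r * ((1 - N + N ^ 2 - N ^ 3) * (1 - r)⁻¹)
      ≤ 1.02 * |α.im| * ((1 - N + N ^ 2 - N ^ 3) * (1 - r)⁻¹) := by gcongr
  have hy : 0 < |α.im| := abs_pos.mpr hα
  have q9 := q5.trans (tb.trans (q7.le.trans q8))
  exact fin_num r |α.im| hr0 hr1 hy q9

theorem g_same_parity_disjoint (a : ℤ) (ha : 3 ≤ a) (α : ℂ)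
    (hroot : α ^ 3 - (a : ℂ) * α ^ 2 + α - 1 = 0) (hα : α.im ≠ 0) :
    (∀ k₁ k₂ : ℤ, 0 ≤ k₁ → k₁ ≤ a - 1 → 0 ≤ k₂ → k₂ ≤ a - 1 → k₁ ≠ k₂ →
      gEven a α k₁ '' Bprime a α ∩ gEven a α k₂ '' Bprime a α = ∅) ∧
    (∀ k₁ k₂ : ℤ, 0 ≤ k₁ → k₁ ≤ a - 2 → 0 ≤ k₂ → k₂ ≤ a - 2 → k₁ ≠ k₂ →
      gOdd α k₁ '' BSet a α (α - 1) ∩ gOdd α k₂ '' BSet a α (α - 1) = ∅) := by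
  have hα0 : α ≠ 0 := by rintro rfl; simp at hα
  constructor
  · intro k₁ k₂ _ _ _ _ hne
    rw [Set.eq_empty_iff_forall_notMem]
    rintro _ ⟨⟨z₁, h₁, rfl⟩, z₂, h₂, he⟩
    have e : z₁ - z₂ = ((k₁ - k₂ : ℤ) : ℂ) * α := by
      apply mul_left_cancel₀ (pow_ne_zero 2 hα0)
      unfold gEven at he
      push_cast
      linear_combination -he
    rcases lt_or_gt_of_ne hne with hlt | hlt
    · refine even_aux a ha α hroot hα z₂ z₁ (k₂ - k₁) (by omega) h₂ h₁ ?_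
      push_cast at e ⊢
      linear_combination -e
    · exact even_aux a ha α hroot hα z₁ z₂ (k₁ - k₂) (by omega) h₁ h₂ e
  · intro k₁ k₂ _ _ _ _ hne
    rw [Set.eq_empty_iff_forall_notMem]
    rintro _ ⟨⟨z₁, h₁, rfl⟩, z₂, h₂, he⟩
    have e : z₁ - z₂ = ((k₁ - k₂ : ℤ) : ℂ) := by
      apply mul_left_cancel₀ (pow_ne_zero 3 hα0)
      unfold gOdd at he
      push_cast
      linear_combination -he
    rcases lt_or_gt_of_ne hne with hlt | hlt
    · refine odd_aux a ha α hroot hα z₂ z₁ (k₂ - k₁) (by omega) h₂ h₁ ?_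
      push_cast at e ⊢
      linear_combination -e
    · exact odd_aux a ha α hroot hα z₁ z₂ (k₁ - k₂) (by omega) h₁ h₂ e
end
end

section
/- For every real number t ∈ [0, 1] there exist a sequence of integers (a_i)_{i≥1} and sequences of non-negative integers (n_i)_{i≥1}, (m_i)_{i≥1} with n₁ = 1, m₁ = 0 and n_i + m_i = i for all i ≥ 1, such that t = a₁/r + Σ_{i=2}^∞ a_i / (r^{n_i}·(r-2)^{m_i}), and the following digit rules hold. (1) If a₁ ∈ {1, 3, 5, …, r-2} ∪ {r-1} then 0 ≤ a₂ ≤ r-1, n₂ = 2, m₂ = 0. (2) If a₁ ∈ {0, 2, 4, …, r-3} then 0 ≤ a₂ ≤ r-3, n₂ = 1, m₂ = 1. For each i ≥ 3: (3) 0 ≤ a_i ≤ r-1, n_i = n_{i-1}+1 and m_i = m_{i-1} if one of the following holds: (3a) a_{i-1} = 0 and i-1 is even; (3b) a_{i-1} = r-1 and i-1 is odd; (3c) a_{i-1} = 2n-1 for some n with 1 ≤ n ≤ a-1; (3d) a_{i-1} = r-3, i-1 is odd, n_{i-1} = n_{i-2} and m_{i-1} = m_{i-2}+1. (4) 0 ≤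 a_i ≤ r-3, n_i = n_{i-1} and m_i = m_{i-1}+1 if one of the following holds: (4a) a_{i-1} = 0 and i-1 is odd; (4b) a_{i-1} = r-1 and i-1 is even; (4c) a_{i-1} = 2n for some n with 1 ≤ n ≤ a-3, or a_{i-1} = r-3 with n_{i-1} = n_{i-2}+1 and m_{i-1} = m_{i-2}; (4d) a_{i-1} = r-3, i-1 is even, n_{i-1} = n_{i-2} and m_{i-1} = m_{i-2}+1. -/
open Classical in
/-- One step of the greedy algorithm: the state is (N, M, type of the current digit, remainder). -/
noncomputable def ueDig (r : ℤ) (s : ℕ × ℕ × Prop × ℝ) : ℤ :=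
  if s.2.2.1 then min ⌊(r : ℝ) * s.2.2.2⌋ (r - 1) else min ⌊((r : ℝ) - 2) * s.2.2.2⌋ (r - 3)

/-- Whether the next digit has base `r`. -/
def ueNext (r : ℤ) (i : ℕ) (b : Prop) (d : ℤ) : Prop :=
  (d = 0 ∧ Even i) ∨ (d = r - 1 ∧ Odd i) ∨ Odd d ∨ (d = r - 3 ∧ Odd i ∧ ¬ b)

open Classical in
noncomputable def ueSeq (r : ℤ) (t : ℝ) : ℕ → ℕ × ℕ × Prop × ℝ
  | 0 => (0, 0, True, t)
  | 1 => (1, 0, True, t)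
  | (i + 2) =>
    let s := ueSeq r t (i + 1)
    let d := ueDig r s
    let c := ueNext r (i + 1) s.2.2.1 d
    (if c then s.1 + 1 else s.1, if c then s.2.1 else s.2.1 + 1, c,
      (if s.2.2.1 then (r : ℝ) else (r : ℝ) - 2) * s.2.2.2 - d)

theorem ue_floor (q : ℤ) (hq : 1 ≤ q) (x : ℝ) (h0 : 0 ≤ x) (h1 : x ≤ 1) :
    0 ≤ min ⌊(q : ℝ) * x⌋ (q - 1) ∧ 0 ≤ (q : ℝ) * x - (min ⌊(q : ℝ) * x⌋ (q - 1) : ℤ) ∧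
      (q : ℝ) * x - (min ⌊(q : ℝ) * x⌋ (q - 1) : ℤ) ≤ 1 := by
  have hq' : (1 : ℝ) ≤ q := by exact_mod_cast hq
  have hx : (0 : ℝ) ≤ q * x := by positivity
  have hf : 0 ≤ ⌊(q : ℝ) * x⌋ := Int.floor_nonneg.mpr hx
  have h2 := Int.floor_le ((q : ℝ) * x)
  have h3 := Int.lt_floor_add_one ((q : ℝ) * x)
  have h4 : (q : ℝ) * x ≤ q := by nlinarith
  rcases le_total ⌊(q : ℝ) * x⌋ (q - 1) with h | h
  · rw [min_eq_left h]
    exact ⟨hf, by linarith, by linarith⟩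
  · rw [min_eq_right h]
    have h' : ((q - 1 : ℤ) : ℝ) ≤ ⌊(q : ℝ) * x⌋ := by exact_mod_cast h
    refine ⟨by omega, by linarith, ?_⟩
    push_cast
    linarith

open Classical in
theorem ue_exists (r : ℤ) (hr : 5 ≤ r) (t : ℝ) (h0 : 0 ≤ t) (h1 : t ≤ 1) :
    ∃ (d : ℕ → ℤ) (N M : ℕ → ℕ) (b : ℕ → Prop) (x : ℕ → ℝ),
      N 1 = 1 ∧ M 1 = 0 ∧ b 1 ∧ x 1 = t ∧
      (∀ i, 1 ≤ i → 0 ≤ x i ∧ x i ≤ 1) ∧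
      (∀ i, 1 ≤ i → 0 ≤ d i ∧ (b i → d i ≤ r - 1) ∧ (¬ b i → d i ≤ r - 3)) ∧
      (∀ i, 1 ≤ i → (b (i + 1) ↔ ueNext r i (b i) (d i))) ∧
      (∀ i, 1 ≤ i → (b (i + 1) → N (i + 1) = N i + 1 ∧ M (i + 1) = M i)) ∧
      (∀ i, 1 ≤ i → (¬ b (i + 1) → N (i + 1) = N i ∧ M (i + 1) = M i + 1)) ∧
      (∀ i, 1 ≤ i → x (i + 1) = (if b i then (r : ℝ) else (r : ℝ) - 2) * x i - d i) := by
  have key : ∀ s : ℕ × ℕ × Prop × ℝ, 0 ≤ s.2.2.2 → s.2.2.2 ≤ 1 →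
      (0 ≤ ueDig r s ∧ 0 ≤ (if s.2.2.1 then (r : ℝ) else (r : ℝ) - 2) * s.2.2.2 - ueDig r s ∧
      (if s.2.2.1 then (r : ℝ) else (r : ℝ) - 2) * s.2.2.2 - ueDig r s ≤ 1) := by
    intro s hs0 hs1
    unfold ueDig
    by_cases hb : s.2.2.1
    · simp only [hb, if_true]
      exact ue_floor r (by omega) _ hs0 hs1
    · simp only [hb, if_false]
      have := ue_floor (r - 2) (by omega) _ hs0 hs1
      have e : r - 2 - 1 = r - 3 := by ring
      rw [e] at this
      push_cast at this ⊢
      exact this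
  have hx : ∀ i, 0 ≤ (ueSeq r t (i + 1)).2.2.2 ∧ (ueSeq r t (i + 1)).2.2.2 ≤ 1 := by
    intro i
    induction i with
    | zero => simp [ueSeq, h0, h1]
    | succ k ih => exact (key _ ih.1 ih.2).2
  refine ⟨fun i => ueDig r (ueSeq r t i), fun i => (ueSeq r t i).1, fun i => (ueSeq r t i).2.1,
    fun i => (ueSeq r t i).2.2.1, fun i => (ueSeq r t i).2.2.2, by simp [ueSeq], by simp [ueSeq],
    by simp [ueSeq], by simp [ueSeq], ?_, ?_, ?_, ?_, ?_, ?_⟩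
  all_goals
    intro i hi
    obtain ⟨i, rfl⟩ : ∃ k, i = k + 1 := ⟨i - 1, by omega⟩
  · exact hx i
  · refine ⟨(key _ (hx i).1 (hx i).2).1, ?_, ?_⟩ <;> intro h <;> simp only [ueDig, h] <;> simp
  · simp only [ueSeq]
  · intro h
    simp only [ueSeq] at h ⊢
    simp [h]
  · intro h
    simp only [ueSeq] at h ⊢
    simp [h]
  · simp only [ueSeq]

/-- For every `t ∈ [0,1]` there is an expansion
`t = a₁/r + Σ_{i≥2} aᵢ/(r^{nᵢ}(r-2)^{mᵢ})` with `r = 2a-1`, whose digits obey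
the transition rules (1)-(4) of Proposition 3.5. -/
theorem unusual_expansion (a : ℤ) (ha : 3 ≤ a) (r : ℤ) (hr : r = 2 * a - 1)
    (t : ℝ) (ht : t ∈ Set.Icc (0 : ℝ) 1) :
    ∃ (d : ℕ → ℤ) (N M : ℕ → ℕ),
      N 1 = 1 ∧ M 1 = 0 ∧ (∀ i, 1 ≤ i → N i + M i = i) ∧
      (0 ≤ d 1 ∧ d 1 ≤ r - 1) ∧
      t = (d 1 : ℝ) / (r : ℝ) +
        ∑' i : ℕ, (d (i + 2) : ℝ) / ((r : ℝ) ^ N (i + 2) * ((r : ℝ) - 2) ^ M (i + 2)) ∧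
      -- rule (1)
      (((Odd (d 1) ∧ 1 ≤ d 1 ∧ d 1 ≤ r - 2) ∨ d 1 = r - 1) →
        (0 ≤ d 2 ∧ d 2 ≤ r - 1 ∧ N 2 = 2 ∧ M 2 = 0)) ∧
      -- rule (2)
      ((Even (d 1) ∧ 0 ≤ d 1 ∧ d 1 ≤ r - 3) →
        (0 ≤ d 2 ∧ d 2 ≤ r - 3 ∧ N 2 = 1 ∧ M 2 = 1)) ∧
      (∀ i, 3 ≤ i →
        -- rule (3): cases (3a), (3b), (3c), (3d)
        (((d (i - 1) = 0 ∧ Even (i - 1)) ∨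
          (d (i - 1) = r - 1 ∧ Odd (i - 1)) ∨
          (∃ n : ℤ, 1 ≤ n ∧ n ≤ a - 1 ∧ d (i - 1) = 2 * n - 1) ∨
          (d (i - 1) = r - 3 ∧ Odd (i - 1) ∧
            N (i - 1) = N (i - 2) ∧ M (i - 1) = M (i - 2) + 1)) →
          (0 ≤ d i ∧ d i ≤ r - 1 ∧ N i = N (i - 1) + 1 ∧ M i = M (i - 1))) ∧
        -- rule (4): cases (4a), (4b), (4c), (4d)
        (((d (i - 1) = 0 ∧ Odd (i - 1)) ∨
          (d (i - 1) = r - 1 ∧ Even (i - 1)) ∨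
          ((∃ n : ℤ, 1 ≤ n ∧ n ≤ a - 3 ∧ d (i - 1) = 2 * n) ∨
            (d (i - 1) = r - 3 ∧ N (i - 1) = N (i - 2) + 1 ∧ M (i - 1) = M (i - 2))) ∨
          (d (i - 1) = r - 3 ∧ Even (i - 1) ∧
            N (i - 1) = N (i - 2) ∧ M (i - 1) = M (i - 2) + 1)) →
          (0 ≤ d i ∧ d i ≤ r - 3 ∧ N i = N (i - 1) ∧ M i = M (i - 1) + 1))) := by
  classical
  obtain ⟨d, N, M, b, x, hN1, hM1, hb1, hx1, hx, hd, hb, hT, hF, hstep⟩ :=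
    ue_exists r (by omega) t ht.1 ht.2
  have hr5 : (5 : ℝ) ≤ r := by exact_mod_cast (show (5 : ℤ) ≤ r by omega)
  have hD3 : ∀ k, (3 : ℝ) ^ (k + 1) ≤ (r : ℝ) ^ N (k + 1) * ((r : ℝ) - 2) ^ M (k + 1) := by
    intro k
    induction k with
    | zero => simp [hN1, hM1]; linarith
    | succ k ih =>
      have hp : (0 : ℝ) < 3 ^ (k + 1) := by positivity
      by_cases h : b (k + 1 + 1)
      · obtain ⟨e1, e2⟩ := hT (k + 1) (by omega) h
        rw [e1, e2, pow_succ, pow_succ (r : ℝ)]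
        nlinarith
      · obtain ⟨e1, e2⟩ := hF (k + 1) (by omega) h
        rw [e1, e2, pow_succ, pow_succ ((r : ℝ) - 2)]
        nlinarith
  have hDpos : ∀ k, (0 : ℝ) < (r : ℝ) ^ N (k + 1) * ((r : ℝ) - 2) ^ M (k + 1) := fun k =>
    lt_of_lt_of_le (by positivity) (hD3 k)
  have hrec : ∀ k, x (k + 2) / ((r : ℝ) ^ N (k + 1) * ((r : ℝ) - 2) ^ M (k + 1)) =
      (d (k + 2) : ℝ) / ((r : ℝ) ^ N (k + 2) * ((r : ℝ) - 2) ^ M (k + 2)) +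
      x (k + 3) / ((r : ℝ) ^ N (k + 2) * ((r : ℝ) - 2) ^ M (k + 2)) := by
    intro k
    have hs := hstep (k + 2) (by omega)
    have hp := hDpos k
    have h1 : (r : ℝ) ≠ 0 := by linarith
    have h2 : (r : ℝ) - 2 ≠ 0 := by intro h; linarith
    have hp1 := pow_ne_zero (N (k + 1)) h1
    have hp2 := pow_ne_zero (M (k + 1)) h2
    rw [show k + 3 = k + 2 + 1 from rfl, hs, ← add_div]
    by_cases h : b (k + 2)
    · obtain ⟨e1, e2⟩ := hT (k + 1) (by omega) h
      rw [show k + 1 + 1 = k + 2 from rfl] at e1 e2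
      rw [e1, e2, if_pos h, pow_succ]
      field_simp
      ring
    · obtain ⟨e1, e2⟩ := hF (k + 1) (by omega) h
      rw [show k + 1 + 1 = k + 2 from rfl] at e1 e2
      rw [e1, e2, if_neg h, pow_succ]
      field_simp
      ring
  have hsum : ∀ n, ∑ i ∈ Finset.range n,
      (d (i + 2) : ℝ) / ((r : ℝ) ^ N (i + 2) * ((r : ℝ) - 2) ^ M (i + 2)) =
      (t - d 1 / r) - x (n + 2) / ((r : ℝ) ^ N (n + 1) * ((r : ℝ) - 2) ^ M (n + 1)) := by
    intro n
    induction n with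
    | zero =>
      have hs := hstep 1 (by omega)
      rw [if_pos hb1, hx1] at hs
      have h1 : (r : ℝ) ≠ 0 := by linarith
      simp only [Finset.range_zero, Finset.sum_empty, zero_add, hN1, hM1]
      rw [show (2 : ℕ) = 1 + 1 from rfl, hs]
      field_simp
      ring
    | succ n ih =>
      rw [Finset.sum_range_succ, ih, hrec n]
      ring_nf
  have hlim : Filter.Tendsto
      (fun n => x (n + 2) / ((r : ℝ) ^ N (n + 1) * ((r : ℝ) - 2) ^ M (n + 1)))
      Filter.atTop (nhds 0) := by
    have hg : Filter.Tendsto (fun n : ℕ => ((1 : ℝ) / 3) ^ (n + 1)) Filter.atTop (nhds 0) :=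
      (Filter.tendsto_add_atTop_iff_nat 1).mpr
        (tendsto_pow_atTop_nhds_zero_of_lt_one (by norm_num) (by norm_num))
    refine squeeze_zero (fun n => div_nonneg (hx (n + 2) (by omega)).1 (hDpos n).le) (fun n => ?_) hg
    rw [div_pow, one_pow]
    exact div_le_div₀ zero_le_one (hx (n + 2) (by omega)).2 (by positivity) (hD3 n)
  have hhas : HasSum (fun i : ℕ =>
      (d (i + 2) : ℝ) / ((r : ℝ) ^ N (i + 2) * ((r : ℝ) - 2) ^ M (i + 2))) (t - d 1 / r) := by
    rw [hasSum_iff_tendsto_nat_of_nonneg]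
    · simp only [hsum]
      simpa using tendsto_const_nhds.sub hlim
    · intro i
      have h := (hd (i + 2) (by omega)).1
      exact div_nonneg (by exact_mod_cast h) (hDpos (i + 1)).le
  have hNb : ∀ i, 1 ≤ i → N i = N (i - 1) + 1 → 2 ≤ i → b i := by
    intro i hi h h2
    obtain ⟨k, rfl⟩ : ∃ k, i = k + 2 := ⟨i - 2, by omega⟩
    by_contra hc
    have := (hF (k + 1) (by omega) hc).1
    simp only [show k + 2 - 1 = k + 1 from rfl, show k + 1 + 1 = k + 2 from rfl] at *
    omega
  have hMb : ∀ i, 1 ≤ i → M i = M (i - 1) + 1 → 2 ≤ i → ¬ b i := by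
    intro i hi h h2 hc
    obtain ⟨k, rfl⟩ : ∃ k, i = k + 2 := ⟨i - 2, by omega⟩
    have := (hT (k + 1) (by omega) hc).2
    simp only [show k + 2 - 1 = k + 1 from rfl, show k + 1 + 1 = k + 2 from rfl] at *
    omega
  have outT : ∀ i, 1 ≤ i → b (i + 1) → (0 ≤ d (i + 1) ∧ d (i + 1) ≤ r - 1 ∧
      N (i + 1) = N i + 1 ∧ M (i + 1) = M i) := fun i hi h =>
    ⟨(hd _ (by omega)).1, (hd _ (by omega)).2.1 h, (hT i hi h).1, (hT i hi h).2⟩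
  have outF : ∀ i, 1 ≤ i → ¬ b (i + 1) → (0 ≤ d (i + 1) ∧ d (i + 1) ≤ r - 3 ∧
      N (i + 1) = N i ∧ M (i + 1) = M i + 1) := fun i hi h =>
    ⟨(hd _ (by omega)).1, (hd _ (by omega)).2.2 h, (hF i hi h).1, (hF i hi h).2⟩
  refine ⟨d, N, M, hN1, hM1, ?_, ⟨(hd 1 le_rfl).1, (hd 1 le_rfl).2.1 hb1⟩, ?_, ?_, ?_, ?_⟩
  · intro i hi
    induction i, hi using Nat.le_induction with
    | base => omega
    | succ i hi ih =>
      by_cases h : b (i + 1)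
      · have := hT i hi h
        omega
      · have := hF i hi h
        omega
  · rw [hhas.tsum_eq]
    ring
  · intro h
    have h2 : b (1 + 1) := by
      rw [hb 1 le_rfl]
      rcases h with h | h
      · exact Or.inr (Or.inr (Or.inl h.1))
      · exact Or.inr (Or.inl ⟨h, by decide⟩)
    have := outT 1 le_rfl h2
    rw [hN1, hM1] at this
    exact this
  · rintro ⟨he, h0, h3⟩
    have h2 : ¬ b (1 + 1) := by
      rw [hb 1 le_rfl]
      rintro (⟨_, h⟩ | ⟨h, _⟩ | h | ⟨_, _, h⟩)
      · exact absurd h (by decide)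
      · omega
      · exact (Int.not_odd_iff_even.mpr he) h
      · exact h hb1
    have := outF 1 le_rfl h2
    rw [hN1, hM1] at this
    exact this
  · intro i hi
    obtain ⟨k, rfl⟩ : ∃ k, i = k + 3 := ⟨i - 3, by omega⟩
    rw [show k + 3 - 1 = k + 2 by omega, show k + 3 - 2 = k + 1 by omega]
    have hbk := hb (k + 2) (by omega)
    have hMk := hMb (k + 2) (by omega)
    have hNk := hNb (k + 2) (by omega)
    rw [show k + 2 - 1 = k + 1 by omega] at hMk hNk
    constructor
    · intro h
      apply outT (k + 2) (by omega)
      rw [hbk]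
      rcases h with h | h | ⟨n, _, _, h⟩ | ⟨h, ho, _, hm⟩
      · exact Or.inl h
      · exact Or.inr (Or.inl h)
      · exact Or.inr (Or.inr (Or.inl ⟨n - 1, by omega⟩))
      · exact Or.inr (Or.inr (Or.inr ⟨h, ho, hMk hm (by omega)⟩))
    · intro h
      apply outF (k + 2) (by omega)
      rw [hbk]
      have hpar : ¬ (Even (k + 2) ∧ Odd (k + 2)) := fun h => (Nat.not_even_iff_odd.mpr h.2) h.1
      rintro (⟨c, h'⟩ | ⟨c, h'⟩ | ⟨m, c⟩ | ⟨c, h', c'⟩)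
      · rcases h with ⟨h, ho⟩ | ⟨h, _⟩ | (⟨n, _, _, h⟩ | ⟨h, _⟩) | ⟨h, _⟩
        · exact hpar ⟨h', ho⟩
        all_goals omega
      · rcases h with ⟨h, ho⟩ | ⟨h, he⟩ | (⟨n, _, _, h⟩ | ⟨h, _⟩) | ⟨h, _⟩
        · omega
        · exact hpar ⟨he, h'⟩
        all_goals omega
      · rcases h with ⟨h, ho⟩ | ⟨h, he⟩ | (⟨n, _, _, h⟩ | ⟨h, _⟩) | ⟨h, _⟩ <;> omega
      · rcases h with ⟨h, ho⟩ | ⟨h, he⟩ | (⟨n, _, _, h⟩ | ⟨h, hn, _⟩) | ⟨h, he, _⟩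
        · omega
        · omega
        · omega
        · exact c' (hNk hn (by omega))
        · exact hpar ⟨he, h'⟩
end
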